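/- arXiv:1908.03080 — 11 statements merged into one kernel-verified Lean document; each statement's English description precedes it below -/
import Mathlib

section
/- Let V be a nonempty finite type, let d : V → ℝ be demands with ∑_{v} d v = 0, and let l, u : V → V → ℝ be lower and upper capacities with l v w ≤ u v w for all v, w. Then there exists a feasible flow, i.e. a function x : V → V → ℝ such that l v w ≤ x v w ≤ u v w for all v, w and, for every vertex v, ∑_{w} x w v = d v + ∑_{w} x v w, if and only if for every finite subset A : Finset V one has ∑_{a ∈ A} ∑_{b ∉ A} u b a ≥ (∑_{v ∈ A} d v) + ∑_{a ∈ A} ∑_{b ∉ A} l a b. -/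
lemma cut_sum {V : Type*} [Fintype V] [DecidableEq V] (x : V → V → ℝ) (A : Finset V) :
    ∑ a ∈ A, (∑ w, x a w - ∑ w, x w a) =
      ∑ a ∈ A, ∑ b ∈ Aᶜ, x a b - ∑ a ∈ A, ∑ b ∈ Aᶜ, x b a := by
  have h : ∀ f : V → ℝ, ∑ w, f w = ∑ w ∈ A, f w + ∑ w ∈ Aᶜ, f w := fun f =>
    (Finset.sum_add_sum_compl A f).symm
  have h1 : ∑ a ∈ A, ∑ w ∈ A, x a w = ∑ a ∈ A, ∑ w ∈ A, x w a := Finset.sum_comm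
  rw [Finset.sum_sub_distrib]
  simp only [h, Finset.sum_add_distrib]
  linarith

lemma first_order {V : Type*} [Fintype V] (e δ : V → ℝ)
    (h : ∀ t : ℝ, 0 ≤ t → t ≤ 1 → ∑ v, e v ^ 2 ≤ ∑ v, (e v + t * δ v) ^ 2) :
    0 ≤ ∑ v, e v * δ v := by
  by_contra! hS
  have hQ : 0 ≤ ∑ v, δ v ^ 2 := Finset.sum_nonneg fun _ _ => sq_nonneg _
  have key : ∀ t : ℝ, ∑ v, (e v + t * δ v) ^ 2 =
      ∑ v, e v ^ 2 + 2 * t * ∑ v, e v * δ v + t ^ 2 * ∑ v, δ v ^ 2 := by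
    intro t
    rw [Finset.mul_sum, Finset.mul_sum, ← Finset.sum_add_distrib, ← Finset.sum_add_distrib]
    exact Finset.sum_congr rfl fun v _ => by ring
  generalize (∑ v, e v * δ v) = S at *
  generalize (∑ v, δ v ^ 2) = Q at *
  have hden : 0 < Q + 1 - S := by linarith
  obtain ⟨t, ht⟩ : ∃ t, t = -S / (Q + 1 - S) := ⟨_, rfl⟩
  have ht0 : 0 < t := ht ▸ div_pos (by linarith) hden
  have htm : t * (Q + 1 - S) = -S := by rw [ht]; field_simp
  have ht1 : t ≤ 1 := by rw [ht, div_le_one hden]; linarith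
  have h2 := h t ht0.le ht1
  rw [key] at h2
  have h3 : 0 ≤ t * (2 * S + t * Q) := by nlinarith
  have h4 : 0 ≤ 2 * S + t * Q := nonneg_of_mul_nonneg_right h3 ht0
  nlinarith [mul_pos ht0 (neg_pos.mpr hS)]

/-- Hoffman's feasible-circulation theorem with balanced demands, on the complete
digraph over a nonempty finite vertex type `V`. -/
theorem hoffman_circulation {V : Type*} [Fintype V] [Nonempty V] [DecidableEq V]
    (d : V → ℝ) (hd : ∑ v, d v = 0)
    (l u : V → V → ℝ) (hlu : ∀ v w, l v w ≤ u v w) :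
    (∃ x : V → V → ℝ,
      (∀ v w, l v w ≤ x v w ∧ x v w ≤ u v w) ∧
      (∀ v, ∑ w, x w v = d v + ∑ w, x v w)) ↔
    (∀ A : Finset V,
      ∑ a ∈ A, ∑ b ∈ Aᶜ, u b a ≥ (∑ v ∈ A, d v) + ∑ a ∈ A, ∑ b ∈ Aᶜ, l a b) := by
  constructor
  · rintro ⟨x, hx, hc⟩ A
    have h1 := cut_sum x A
    have h2 : ∑ a ∈ A, (∑ w, x a w - ∑ w, x w a) = - ∑ a ∈ A, d a := by
      rw [← Finset.sum_neg_distrib]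
      exact Finset.sum_congr rfl fun a _ => by rw [hc a]; ring
    have h3 : ∑ a ∈ A, ∑ b ∈ Aᶜ, l a b ≤ ∑ a ∈ A, ∑ b ∈ Aᶜ, x a b :=
      Finset.sum_le_sum fun a _ => Finset.sum_le_sum fun b _ => (hx a b).1
    have h4 : ∑ a ∈ A, ∑ b ∈ Aᶜ, x b a ≤ ∑ a ∈ A, ∑ b ∈ Aᶜ, u b a :=
      Finset.sum_le_sum fun a _ => Finset.sum_le_sum fun b _ => (hx b a).2
    linarith
  · intro H
    let E : (V → V → ℝ) → V → ℝ := fun x v => d v + (∑ w, x v w - ∑ w, x w v)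
    have hcomp : IsCompact (Set.Icc l u) := by
      have := isCompact_univ_pi (fun v => isCompact_univ_pi (fun w => isCompact_Icc (a := l v w) (b := u v w)))
      convert this using 1
      ext x
      simp only [Set.mem_Icc, Pi.le_def, Set.mem_pi, Set.mem_univ, true_imp_iff]
      exact ⟨fun h v w => ⟨h.1 v w, h.2 v w⟩, fun h => ⟨fun v w => (h v w).1, fun v w => (h v w).2⟩⟩
    obtain ⟨x, hxK, hmin⟩ := hcomp.exists_isMinOn (f := fun x => ∑ v, E x v ^ 2)
      ⟨l, le_refl _, fun v w => hlu v w⟩ (by fun_prop)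
    have hl : ∀ v w, l v w ≤ x v w := fun v w => hxK.1 v w
    have hu : ∀ v w, x v w ≤ u v w := fun v w => hxK.2 v w
    obtain ⟨e, he⟩ : ∃ e, e = E x := ⟨_, rfl⟩
    let z : V → V → ℝ := fun v w =>
      if e w < e v then l v w - x v w else if e v < e w then u v w - x v w else 0
    have hz : ∀ v w, l v w - x v w ≤ z v w ∧ z v w ≤ u v w - x v w := by
      intro v w
      have := hl v w
      have := hu v w
      simp only [z]
      split_ifs <;> constructor <;> linarith
    have hzs : ∀ v w, z v w * (e v - e w) ≤ 0 := by
      intro v w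
      have := hl v w
      have := hu v w
      simp only [z]
      split_ifs <;> nlinarith
    have hfo := first_order e (fun v => ∑ w, z v w - ∑ w, z w v) (by
      intro t ht0 ht1
      have hm : x + t • z ∈ Set.Icc l u := by
        constructor <;> intro v w <;> simp only [Pi.add_apply, Pi.smul_apply, smul_eq_mul] <;>
          nlinarith [hl v w, hu v w, (hz v w).1, (hz v w).2]
      have h1 := hmin hm
      simp only [Set.mem_setOf_eq] at h1
      rw [← he] at h1
      refine h1.trans_eq (Finset.sum_congr rfl fun v _ => ?_)
      rw [he]
      simp only [E, Pi.add_apply, Pi.smul_apply, smul_eq_mul, Finset.sum_add_distrib,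
        ← Finset.mul_sum]
      ring)
    have hsum : ∑ v, e v * (∑ w, z v w - ∑ w, z w v) = ∑ v, ∑ w, z v w * (e v - e w) := by
      have h1 : ∑ v, ∑ w, z w v * e v = ∑ v, ∑ w, z v w * e w := Finset.sum_comm
      simp only [mul_sub, Finset.sum_sub_distrib, Finset.mul_sum]
      rw [← h1]
      simp only [mul_comm]
    rw [hsum] at hfo
    have hzero : ∀ v w, z v w * (e v - e w) = 0 := by
      have h0 : ∑ v, ∑ w, z v w * (e v - e w) = 0 := le_antisymm
        (Finset.sum_nonpos fun v _ => Finset.sum_nonpos fun w _ => hzs v w) hfo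
      intro v w
      have h1 := (Finset.sum_eq_zero_iff_of_nonpos
        (fun v _ => Finset.sum_nonpos fun w _ => hzs v w)).1 h0 v (Finset.mem_univ _)
      exact (Finset.sum_eq_zero_iff_of_nonpos (fun w _ => hzs v w)).1 h1 w (Finset.mem_univ _)
    have hxl : ∀ v w, e w < e v → x v w = l v w := by
      intro v w h
      have h1 := (mul_eq_zero.1 (hzero v w)).resolve_right (by linarith)
      simp only [z, if_pos h] at h1
      linarith
    have hxu : ∀ v w, e v < e w → x v w = u v w := by
      intro v w h
      have h1 := (mul_eq_zero.1 (hzero v w)).resolve_right (by linarith)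
      simp only [z, if_pos h, if_neg h.not_gt] at h1
      linarith
    have hev : ∀ v, e v = d v + (∑ w, x v w - ∑ w, x w v) := fun v => by rw [he]
    have htot : ∑ v, e v = 0 := by
      simp only [hev, Finset.sum_add_distrib, hd, Finset.sum_sub_distrib]
      rw [Finset.sum_comm]; ring
    have hle : ∀ v, e v ≤ 0 := by
      by_contra! hex
      obtain ⟨v0, hv0⟩ := hex
      let A : Finset V := Finset.univ.filter fun v => 0 < e v
      have hA : ∀ v, v ∈ A ↔ 0 < e v := fun v => by simp [A]
      have hpos : 0 < ∑ v ∈ A, e v :=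
        Finset.sum_pos (fun v hv => (hA v).1 hv) ⟨v0, (hA v0).2 hv0⟩
      have hlt : ∀ a ∈ A, ∀ b ∈ Aᶜ, e b < e a := by
        intro a ha b hb
        rw [Finset.mem_compl, hA, not_lt] at hb
        exact hb.trans_lt ((hA a).1 ha)
      have h1 := cut_sum x A
      have h2 : ∑ a ∈ A, ∑ b ∈ Aᶜ, x a b = ∑ a ∈ A, ∑ b ∈ Aᶜ, l a b :=
        Finset.sum_congr rfl fun a ha => Finset.sum_congr rfl fun b hb => hxl a b (hlt a ha b hb)
      have h3 : ∑ a ∈ A, ∑ b ∈ Aᶜ, x b a = ∑ a ∈ A, ∑ b ∈ Aᶜ, u b a :=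
        Finset.sum_congr rfl fun a ha => Finset.sum_congr rfl fun b hb => hxu b a (hlt a ha b hb)
      have h4 : ∑ v ∈ A, e v = ∑ v ∈ A, d v + ∑ a ∈ A, (∑ w, x a w - ∑ w, x w a) := by
        rw [← Finset.sum_add_distrib]
        exact Finset.sum_congr rfl fun v _ => hev v
      have := H A
      linarith
    refine ⟨x, fun v w => ⟨hl v w, hu v w⟩, fun v => ?_⟩
    have h1 := (Finset.sum_eq_zero_iff_of_nonpos (fun v _ => hle v)).1 htot v (Finset.mem_univ _)
    rw [hev] at h1
    linarith
end

section
/- Assume ∑_{t} p t = ∑_{n} E n and xlo n t ≤ xhi n t for all n, t. Then there exists x : Fin N → Fin T → ℝ with x ∈ X ∩ Y (i.e. p is disaggregable) if and only if for every T0 : Finset (Fin T) and every N0 : Finset (Fin N), ∑_{t ∈ T0} p t − ∑_{n ∈ N0} E n + ∑_{t ∉ T0} ∑_{n ∈ N0} xlo n t ≤ ∑_{t ∈ T0} ∑_{n ∉ N0} xhi n t. -/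
lemma sum_sq_perturb {k : ℕ} (a : Fin k → ℝ) (j : Fin k) (s : ℝ) :
    ∑ i, (a i + if i = j then s else 0) ^ 2 = ∑ i, a i ^ 2 + (2 * s * a j + s ^ 2) := by
  have h : ∀ i, (a i + if i = j then s else 0) ^ 2
      = a i ^ 2 + if i = j then 2 * s * a j + s ^ 2 else 0 := by
    intro i
    by_cases h : i = j
    · subst h; simp; ring
    · simp [h]
  simp_rw [h, Finset.sum_add_distrib]
  simp

/-- A minimizer of the squared residuals over the box, with its first order conditions. -/
lemma exists_min_residual (N T : ℕ)
    (E : Fin N → ℝ) (xlo xhi : Fin N → Fin T → ℝ) (p : Fin T → ℝ)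
    (hbounds : ∀ n t, xlo n t ≤ xhi n t) :
    ∃ x : Fin N → Fin T → ℝ, (∀ n t, xlo n t ≤ x n t ∧ x n t ≤ xhi n t) ∧
      ∀ n t s, xlo n t ≤ x n t + s → x n t + s ≤ xhi n t →
        0 ≤ 2 * s * ((∑ t', x n t' - E n) + (∑ n', x n' t - p t)) + 2 * s ^ 2 := by
  have hc : IsCompact (Set.Icc xlo xhi) := by
    have : Set.Icc xlo xhi = Set.univ.pi fun n => Set.univ.pi fun t => Set.Icc (xlo n t) (xhi n t) := by
      ext x
      simp only [Set.mem_Icc, Set.mem_pi, Set.mem_univ, true_implies, Pi.le_def]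
      exact ⟨fun h n t => ⟨h.1 n t, h.2 n t⟩, fun h => ⟨fun n t => (h n t).1, fun n t => (h n t).2⟩⟩
    rw [this]
    exact isCompact_univ_pi fun n => isCompact_univ_pi fun t => isCompact_Icc
  obtain ⟨x, hx, hmin⟩ := hc.exists_isMinOn (f := fun x : Fin N → Fin T → ℝ =>
    ∑ n, (∑ t, x n t - E n) ^ 2 + ∑ t, (∑ n, x n t - p t) ^ 2)
    ⟨xlo, le_refl _, fun n t => hbounds n t⟩ (by fun_prop)
  refine ⟨x, fun n t => ⟨hx.1 n t, hx.2 n t⟩, ?_⟩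
  intro n t s h1 h2
  have hy : (fun n' t' => x n' t' + if n' = n ∧ t' = t then s else 0) ∈ Set.Icc xlo xhi := by
    constructor
    · intro n' t'
      by_cases h : n' = n ∧ t' = t
      · obtain ⟨rfl, rfl⟩ := h; simpa using h1
      · simpa [h] using hx.1 n' t'
    · intro n' t'
      by_cases h : n' = n ∧ t' = t
      · obtain ⟨rfl, rfl⟩ := h; simpa using h2
      · simpa [h] using hx.2 n' t'
  have hm := isMinOn_iff.1 hmin _ hy
  have e1 : ∀ n', ∑ t', (x n' t' + if n' = n ∧ t' = t then s else 0) - E n'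
      = (∑ t', x n' t' - E n') + if n' = n then s else 0 := by
    intro n'
    rw [Finset.sum_add_distrib]
    by_cases h : n' = n <;> simp [h]; ring
  have e2 : ∀ t', ∑ n', (x n' t' + if n' = n ∧ t' = t then s else 0) - p t'
      = (∑ n', x n' t' - p t') + if t' = t then s else 0 := by
    intro t'
    rw [Finset.sum_add_distrib]
    by_cases h : t' = t <;> simp [h]; ring
  simp only [e1, e2, sum_sq_perturb] at hm
  linarith

/-- An aggregate allocation `p` is disaggregable (there is a profile in `X ∩ Y`)
iff all Hoffman inequalities hold. -/
theorem disaggregation_iff_hoffman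
    (N T : ℕ) (hN : 1 ≤ N) (hT : 1 ≤ T)
    (E : Fin N → ℝ) (xlo xhi : Fin N → Fin T → ℝ) (p : Fin T → ℝ)
    (hsum : ∑ t, p t = ∑ n, E n)
    (hbounds : ∀ n t, xlo n t ≤ xhi n t) :
    (∃ x : Fin N → Fin T → ℝ,
      ((∀ n, ∑ t, x n t = E n) ∧ (∀ n t, xlo n t ≤ x n t ∧ x n t ≤ xhi n t)) ∧
      (∀ t, ∑ n, x n t = p t)) ↔
    (∀ (T0 : Finset (Fin T)) (N0 : Finset (Fin N)),
      ∑ t ∈ T0, p t - ∑ n ∈ N0, E n + ∑ t ∈ T0ᶜ, ∑ n ∈ N0, xlo n t ≤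
        ∑ t ∈ T0, ∑ n ∈ N0ᶜ, xhi n t) := by
  have key : ∀ (x : Fin N → Fin T → ℝ) (T0 : Finset (Fin T)) (N0 : Finset (Fin N)),
      ∑ t ∈ T0, ∑ n, x n t - ∑ n ∈ N0, ∑ t, x n t + ∑ t ∈ T0ᶜ, ∑ n ∈ N0, x n t
        = ∑ t ∈ T0, ∑ n ∈ N0ᶜ, x n t := by
    intro x T0 N0
    have h1 : ∑ t ∈ T0, ∑ n, x n t
        = ∑ t ∈ T0, ∑ n ∈ N0, x n t + ∑ t ∈ T0, ∑ n ∈ N0ᶜ, x n t := by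
      rw [← Finset.sum_add_distrib]
      exact Finset.sum_congr rfl fun t _ => (Finset.sum_add_sum_compl N0 _).symm
    have h2 : ∑ n ∈ N0, ∑ t, x n t
        = ∑ t ∈ T0, ∑ n ∈ N0, x n t + ∑ t ∈ T0ᶜ, ∑ n ∈ N0, x n t := by
      rw [Finset.sum_add_sum_compl, Finset.sum_comm]
    linarith
  constructor
  · rintro ⟨x, ⟨hE, hb⟩, hp⟩ T0 N0
    have hk := key x T0 N0
    simp only [hE, hp] at hk
    have h1 : ∑ t ∈ T0ᶜ, ∑ n ∈ N0, xlo n t ≤ ∑ t ∈ T0ᶜ, ∑ n ∈ N0, x n t :=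
      Finset.sum_le_sum fun t _ => Finset.sum_le_sum fun n _ => (hb n t).1
    have h2 : ∑ t ∈ T0, ∑ n ∈ N0ᶜ, x n t ≤ ∑ t ∈ T0, ∑ n ∈ N0ᶜ, xhi n t :=
      Finset.sum_le_sum fun t _ => Finset.sum_le_sum fun n _ => (hb n t).2
    linarith
  · intro H
    obtain ⟨x, hb, hs⟩ := exists_min_residual N T E xlo xhi p hbounds
    obtain ⟨r, hr⟩ : ∃ r : Fin N → ℝ, ∀ n, r n = ∑ t, x n t - E n := ⟨_, fun _ => rfl⟩
    obtain ⟨c, hc⟩ : ∃ c : Fin T → ℝ, ∀ t, c t = ∑ n, x n t - p t := ⟨_, fun _ => rfl⟩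
    simp only [← hr, ← hc] at hs
    have klo : ∀ n t, 0 < r n + c t → xlo n t = x n t := by
      intro n t hpos
      by_contra hne
      have hlt : 0 < x n t - xlo n t := sub_pos.2 (lt_of_le_of_ne (hb n t).1 hne)
      obtain ⟨d, hd0, hd⟩ := exists_between (lt_min hlt hpos)
      have hd1 := hd.trans_le (min_le_left _ _)
      have hd2 := hd.trans_le (min_le_right _ _)
      have := hs n t (-d) (by linarith) (by linarith [(hb n t).2])
      nlinarith [mul_pos hd0 (sub_pos.2 hd2)]
    have khi : ∀ n t, r n + c t < 0 → xhi n t = x n t := by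
      intro n t hneg
      by_contra hne
      have hlt : 0 < xhi n t - x n t := sub_pos.2 (lt_of_le_of_ne (hb n t).2 (Ne.symm hne))
      obtain ⟨d, hd0, hd⟩ := exists_between (lt_min hlt (neg_pos.2 hneg))
      have hd1 := hd.trans_le (min_le_left _ _)
      have hd2 := hd.trans_le (min_le_right _ _)
      have := hs n t d (by linarith [(hb n t).1]) (by linarith)
      nlinarith [mul_pos hd0 (sub_pos.2 hd2)]
    have hH := H (Finset.univ.filter fun t => c t < 0) (Finset.univ.filter fun n => 0 < r n)
    have hk := key x (Finset.univ.filter fun t => c t < 0) (Finset.univ.filter fun n => 0 < r n)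
    set T0 := Finset.univ.filter fun t => c t < 0 with hT0
    set N0 := Finset.univ.filter fun n => 0 < r n with hN0
    have e1 : ∑ t ∈ T0ᶜ, ∑ n ∈ N0, xlo n t = ∑ t ∈ T0ᶜ, ∑ n ∈ N0, x n t := by
      refine Finset.sum_congr rfl fun t ht => Finset.sum_congr rfl fun n hn => klo n t ?_
      simp [hT0] at ht
      simp [hN0] at hn
      linarith
    have e2 : ∑ t ∈ T0, ∑ n ∈ N0ᶜ, xhi n t = ∑ t ∈ T0, ∑ n ∈ N0ᶜ, x n t := by
      refine Finset.sum_congr rfl fun t ht => Finset.sum_congr rfl fun n hn => khi n t ?_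
      simp [hT0] at ht
      simp [hN0] at hn
      linarith
    have s1 : ∑ n ∈ N0, r n = ∑ n ∈ N0, ∑ t, x n t - ∑ n ∈ N0, E n := by
      simp only [hr, Finset.sum_sub_distrib]
    have s2 : ∑ t ∈ T0, c t = ∑ t ∈ T0, ∑ n, x n t - ∑ t ∈ T0, p t := by
      simp only [hc, Finset.sum_sub_distrib]
    have hle : ∑ n ∈ N0, r n ≤ ∑ t ∈ T0, c t := by linarith
    have hr0 : ∀ n ∈ N0, 0 ≤ r n := fun n hn => by
      simp [hN0] at hn
      exact hn.le
    have hc0 : ∀ t ∈ T0, c t ≤ 0 := fun t ht => by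
      simp [hT0] at ht
      exact ht.le
    have p1 := Finset.sum_nonneg hr0
    have p2 := Finset.sum_nonpos hc0
    have z1 := (Finset.sum_eq_zero_iff_of_nonneg hr0).1 (by linarith)
    have z2 := (Finset.sum_eq_zero_iff_of_nonpos hc0).1 (by linarith)
    have rn : ∀ n, r n ≤ 0 := by
      intro n
      by_contra h
      have := z1 n (by simp [hN0]; linarith)
      linarith
    have cn : ∀ t, 0 ≤ c t := by
      intro t
      by_contra h
      have := z2 t (by simp [hT0]; linarith)
      linarith
    have tot : ∑ n, r n = ∑ t, c t := by
      simp only [hr, hc, Finset.sum_sub_distrib]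
      rw [Finset.sum_comm, hsum]
    have q1 : ∑ n, r n ≤ 0 := Finset.sum_nonpos fun n _ => rn n
    have q2 : 0 ≤ ∑ t, c t := Finset.sum_nonneg fun t _ => cn t
    have w1 := (Finset.sum_eq_zero_iff_of_nonpos fun n _ => rn n).1 (show ∑ n, r n = 0 by linarith)
    have w2 := (Finset.sum_eq_zero_iff_of_nonneg fun t _ => cn t).1 (show ∑ t, c t = 0 by linarith)
    refine ⟨x, ⟨fun n => ?_, hb⟩, fun t => ?_⟩
    · linarith [hr n, w1 n (Finset.mem_univ _)]
    · linarith [hc t, w2 t (Finset.mem_univ _)]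
end

section
/- Let H be a real Hilbert space, let X ⊆ H be a nonempty compact convex set and Y ⊆ H a nonempty closed convex set. Let (x_k)_{k≥1} and (y_k)_{k≥0} be alternate-projections sequences: y_0 ∈ H is arbitrary, and for every k, x_{k+1} is the unique nearest point of X to y_k and y_{k+1} is the unique nearest point of Y to x_{k+1}. Then there exist x∞ ∈ X and y∞ ∈ Y such that x_k → x∞, y_k → y∞, and ‖x∞ − y∞‖ = ⨅_{x ∈ X, y ∈ Y} ‖x − y‖. In particular, if X ∩ Y ≠ ∅ then both sequences converge to a common point of X ∩ Y. -/
/-- `p` is a nearest point of `C` to `z`. -/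
def ApmNearest {H : Type*} [NormedAddCommGroup H] (C : Set H) (z p : H) : Prop :=
  p ∈ C ∧ ∀ c ∈ C, ‖z - p‖ ≤ ‖z - c‖

theorem apm_exists {H : Type*} [NormedAddCommGroup H] [InnerProductSpace ℝ H]
    {C : Set H} (hne : C.Nonempty) (hc : IsComplete C) (hconv : Convex ℝ C) (z : H) :
    ∃ p, ApmNearest C z p := by
  obtain ⟨v, hv, h⟩ := exists_norm_eq_iInf_of_complete_convex hne hc hconv z
  refine ⟨v, hv, fun c hc => ?_⟩
  rw [h]
  exact ciInf_le (f := fun w : C => ‖z - w‖) ⟨0, by rintro _ ⟨w, rfl⟩; exact norm_nonneg _⟩ ⟨c, hc⟩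

theorem apm_inner {H : Type*} [NormedAddCommGroup H] [InnerProductSpace ℝ H]
    {C : Set H} (hconv : Convex ℝ C) {z p : H} (h : ApmNearest C z p) :
    ∀ c ∈ C, inner ℝ (z - p) (c - p) ≤ 0 := by
  refine (norm_eq_iInf_iff_real_inner_le_zero hconv h.1).1 ?_
  have : Nonempty C := ⟨⟨p, h.1⟩⟩
  apply le_antisymm
  · exact le_ciInf fun w => h.2 w w.2
  · exact ciInf_le (f := fun w : C => ‖z - w‖)
      ⟨0, by rintro _ ⟨w, rfl⟩; exact norm_nonneg _⟩ ⟨p, h.1⟩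

theorem apm_nonexp {H : Type*} [NormedAddCommGroup H] [InnerProductSpace ℝ H]
    {C : Set H} (hconv : Convex ℝ C) {z p w q : H} (h : ApmNearest C z p)
    (h' : ApmNearest C w q) : ‖p - q‖ ≤ ‖z - w‖ := by
  have h1 := apm_inner hconv h q h'.1
  have h2 := apm_inner hconv h' p h.1
  have h3 : inner ℝ (p - q) (p - q) ≤ inner ℝ (z - w) (p - q) := by
    simp only [inner_sub_left, inner_sub_right] at *
    linarith
  rw [real_inner_self_eq_norm_mul_norm] at h3
  have h4 := real_inner_le_norm (z - w) (p - q)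
  by_contra! hlt
  nlinarith [norm_nonneg (p - q), norm_nonneg (z - w)]

theorem apm_pyth {H : Type*} [NormedAddCommGroup H] [InnerProductSpace ℝ H]
    {C : Set H} (hconv : Convex ℝ C) {z p c : H} (h : ApmNearest C z p)
    (hc : c ∈ C) : ‖z - p‖ ^ 2 + ‖p - c‖ ^ 2 ≤ ‖z - c‖ ^ 2 := by
  have h1 := apm_inner hconv h c hc
  have h2 : z - c = (z - p) - (c - p) := by abel
  rw [h2, norm_sub_sq_real (z - p) (c - p), norm_sub_rev p c]
  linarith

theorem apm_min {H : Type*} [NormedAddCommGroup H] [InnerProductSpace ℝ H]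
    {X Y : Set H} (hX : Convex ℝ X) (hY : Convex ℝ Y) {a b c e : H}
    (ha : ApmNearest X b a) (hb : ApmNearest Y a b) (hc : c ∈ X) (he : e ∈ Y) :
    ‖a - b‖ ≤ ‖c - e‖ := by
  have h1 := apm_inner hX ha c hc
  have h2 := apm_inner hY hb e he
  have h3 : inner ℝ (a - b) (a - b) ≤ inner ℝ (a - b) (c - e) := by
    simp only [inner_sub_left, inner_sub_right] at *
    linarith
  rw [real_inner_self_eq_norm_mul_norm] at h3
  have h4 := real_inner_le_norm (a - b) (c - e)
  by_contra! hlt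
  nlinarith [norm_nonneg (a - b), norm_nonneg (c - e)]

open Filter Topology in
theorem apm_proj_tendsto {H : Type*} [NormedAddCommGroup H] [InnerProductSpace ℝ H]
    {C : Set H} (hconv : Convex ℝ C) {u v : ℕ → H} {a b : H}
    (h : ∀ k, ApmNearest C (u k) (v k)) (hab : ApmNearest C a b)
    (hu : Tendsto u atTop (𝓝 a)) : Tendsto v atTop (𝓝 b) := by
  rw [tendsto_iff_norm_sub_tendsto_zero] at *
  exact squeeze_zero (fun _ => norm_nonneg _) (fun k => apm_nonexp hconv (h k) hab) hu

/-- Gubin–Polyak–Raik convergence theorem for the method of alternate projections: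
on a compact convex set `X` and a closed convex set `Y` in a real Hilbert space,
the alternate-projections sequences converge to a pair realizing the minimal
distance between `X` and `Y`; in particular, if `X ∩ Y ≠ ∅`, both sequences
converge to a common point of `X ∩ Y`. -/
theorem apm_convergence {H : Type*} [NormedAddCommGroup H] [InnerProductSpace ℝ H]
    [CompleteSpace H]
    (X Y : Set H) (hXne : X.Nonempty) (hXcomp : IsCompact X) (hXconv : Convex ℝ X)
    (hYne : Y.Nonempty) (hYcl : IsClosed Y) (hYconv : Convex ℝ Y)
    (x y : ℕ → H)
    (hx : ∀ k, x (k + 1) ∈ X ∧ ∀ c ∈ X, ‖y k - x (k + 1)‖ ≤ ‖y k - c‖)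
    (hy : ∀ k, y (k + 1) ∈ Y ∧ ∀ c ∈ Y, ‖x (k + 1) - y (k + 1)‖ ≤ ‖x (k + 1) - c‖) :
    ∃ xLim ∈ X, ∃ yLim ∈ Y,
      Filter.Tendsto x Filter.atTop (nhds xLim) ∧
      Filter.Tendsto y Filter.atTop (nhds yLim) ∧
      ‖xLim - yLim‖ = ⨅ (a : X) (b : Y), ‖(a : H) - (b : H)‖ ∧
      ((X ∩ Y).Nonempty → xLim = yLim ∧ xLim ∈ X ∩ Y) := by
  have hx' : ∀ k, ApmNearest X (y k) (x (k + 1)) := hx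
  have hy' : ∀ k, ApmNearest Y (x (k + 1)) (y (k + 1)) := hy
  -- successive differences of `y` tend to zero
  have hstep : ∀ k, ‖x (k + 2) - y (k + 2)‖ ^ 2 + ‖y (k + 2) - y (k + 1)‖ ^ 2
      ≤ ‖x (k + 1) - y (k + 1)‖ ^ 2 := by
    intro k
    have h1 := apm_pyth hYconv (hy' (k + 1)) (hy' k).1
    have h2 := (hx' (k + 1)).2 (x (k + 1)) (hx' k).1
    rw [norm_sub_rev, norm_sub_rev (y (k + 1))] at h2
    have h3 := pow_le_pow_left₀ (norm_nonneg _) h2 2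
    exact h1.trans h3
  have hanti : Antitone fun k => ‖x (k + 1) - y (k + 1)‖ ^ 2 :=
    antitone_nat_of_succ_le fun k => by nlinarith [hstep k, sq_nonneg ‖y (k + 2) - y (k + 1)‖]
  have hlim := tendsto_atTop_ciInf hanti ⟨0, by rintro _ ⟨w, rfl⟩; positivity⟩
  have hdiff : Filter.Tendsto (fun k => y (k + 2) - y (k + 1)) Filter.atTop (nhds 0) := by
    have h0 := hlim.sub (hlim.comp (Filter.tendsto_add_atTop_nat 1))
    rw [sub_self] at h0
    have h1 : Filter.Tendsto (fun k => ‖y (k + 2) - y (k + 1)‖ ^ 2) Filter.atTop (nhds 0) :=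
      squeeze_zero (fun _ => by positivity) (fun k => by
        have := hstep k
        simp only [Function.comp]
        show _ ≤ ‖x (k + 1) - y (k + 1)‖ ^ 2 - ‖x (k + 2) - y (k + 2)‖ ^ 2
        linarith) h0
    have h2 := h1.sqrt
    simp only [Real.sqrt_sq (norm_nonneg _), Real.sqrt_zero] at h2
    exact tendsto_zero_iff_norm_tendsto_zero.2 h2
  obtain ⟨a₀, -, φ, hφ, ha₀⟩ := hXcomp.tendsto_subseq (fun k => (hx' k).1)
  obtain ⟨b, hb⟩ := apm_exists hYne hYcl.isComplete hYconv a₀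
  obtain ⟨a, ha⟩ := apm_exists hXne hXcomp.isComplete hXconv b
  obtain ⟨b', hb'⟩ := apm_exists hYne hYcl.isComplete hYconv a
  have t1 : Filter.Tendsto (fun j => y (φ j + 1)) Filter.atTop (nhds b) :=
    apm_proj_tendsto hYconv (fun j => hy' (φ j)) hb ha₀
  have t2 : Filter.Tendsto (fun j => x (φ j + 2)) Filter.atTop (nhds a) :=
    apm_proj_tendsto hXconv (fun j => hx' (φ j + 1)) ha t1
  have t3 : Filter.Tendsto (fun j => y (φ j + 2)) Filter.atTop (nhds b') :=
    apm_proj_tendsto hYconv (fun j => hy' (φ j + 1)) hb' t2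
  have t4 : Filter.Tendsto (fun j => y (φ j + 2)) Filter.atTop (nhds b) := by
    have := (hdiff.comp hφ.tendsto_atTop).add t1
    simpa [Function.comp_def] using this
  obtain rfl := tendsto_nhds_unique t3 t4
  have hFejer : Antitone fun k => ‖x (k + 1) - a‖ :=
    antitone_nat_of_succ_le fun k =>
      (apm_nonexp hXconv (hx' (k + 1)) ha).trans (apm_nonexp hYconv (hy' k) hb')
  have hl := tendsto_atTop_ciInf hFejer ⟨0, by rintro _ ⟨w, rfl⟩; exact norm_nonneg _⟩
  have hl2 := hl.comp ((Filter.tendsto_add_atTop_nat 1).comp hφ.tendsto_atTop)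
  have hl3 := tendsto_iff_norm_sub_tendsto_zero.1 t2
  rw [tendsto_nhds_unique hl2 hl3] at hl
  have hxt : Filter.Tendsto (fun k => x (k + 1)) Filter.atTop (nhds a) := tendsto_iff_norm_sub_tendsto_zero.2 hl
  have hyt : Filter.Tendsto (fun k => y (k + 1)) Filter.atTop (nhds b') := apm_proj_tendsto hYconv hy' hb' hxt
  refine ⟨a, ha.1, b', hb'.1, (Filter.tendsto_add_atTop_iff_nat 1).1 hxt,
    (Filter.tendsto_add_atTop_iff_nat 1).1 hyt, ?_, ?_⟩
  · have := hXne.to_subtype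
    have := hYne.to_subtype
    apply le_antisymm
    · exact le_ciInf fun c => le_ciInf fun e => apm_min hXconv hYconv ha hb' c.2 e.2
    · refine ciInf_le_of_le ⟨0, ?_⟩ ⟨a, ha.1⟩ (ciInf_le_of_le ⟨0, ?_⟩ ⟨b', hb'.1⟩ le_rfl)
      · rintro _ ⟨w, rfl⟩
        exact Real.iInf_nonneg fun _ => norm_nonneg _
      · rintro _ ⟨w, rfl⟩
        exact norm_nonneg _
  · rintro ⟨p, hpX, hpY⟩
    have h := apm_min hXconv hYconv ha hb' hpX hpY
    rw [sub_self, norm_zero] at h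
    have heq : a = b' := sub_eq_zero.1 (norm_le_zero_iff.1 h)
    exact ⟨heq, ha.1, heq ▸ hb'.1⟩
end

section
/- Assume the aggregate conditions and the individual feasibility conditions. Let (x∞, y∞) ∈ X × Y be a pair achieving the minimum of ‖x − y‖ over X × Y, and assume x∞ ≠ y∞ (equivalently X ∩ Y = ∅). Define T0 = {t | ∃ n, y∞ n t > xhi n t} and N0 = {n | E n − ∑_{t ∉ T0} xlo n t − ∑_{t ∈ T0} xhi n t < 0}. Then the Hoffman inequality indexed by (T0, N0) is violated by p: ∑_{n ∈ N0} E n − ∑_{t ∈ T0} p t + ∑_{t ∈ T0} ∑_{n ∉ N0} xhi n t − ∑_{t ∉ T0} ∑_{n ∈ N0} xlo n t < 0; moreover this inequality can be written as ∑_{t ∈ T0} ∑_{n} x∞ n t < ∑_{t ∈ T0} p t. -/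
/-- If `(xs, ys)` realizes the minimal distance between the transportation polytope
`X` and the aggregation affine set `Y`, with `xs ≠ ys`, then the Hoffman inequality
indexed by the sets `T0, N0` constructed from `ys` is violated by `p`, and it can be
rewritten as `∑_{t ∈ T0} ∑_n xs n t < ∑_{t ∈ T0} p t`. -/
theorem generated_cut_violated
    (N T : ℕ) (hN : 1 ≤ N) (hT : 1 ≤ T)
    (E : Fin N → ℝ) (xlo xhi : Fin N → Fin T → ℝ) (p : Fin T → ℝ)
    (hagg1 : ∑ t, p t = ∑ n, E n)
    (hagg2 : ∀ t, ∑ n, xlo n t ≤ p t ∧ p t ≤ ∑ n, xhi n t)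
    (hfeas1 : ∀ n t, xlo n t ≤ xhi n t)
    (hfeas2 : ∀ n, ∑ t, xlo n t ≤ E n ∧ E n ≤ ∑ t, xhi n t)
    (xs ys : EuclideanSpace ℝ (Fin N × Fin T))
    (hxsX : (∀ n, ∑ t, xs (n, t) = E n) ∧ ∀ n t, xlo n t ≤ xs (n, t) ∧ xs (n, t) ≤ xhi n t)
    (hysY : ∀ t, ∑ n, ys (n, t) = p t)
    (hmin : ∀ a b : EuclideanSpace ℝ (Fin N × Fin T),
      ((∀ n, ∑ t, a (n, t) = E n) ∧ ∀ n t, xlo n t ≤ a (n, t) ∧ a (n, t) ≤ xhi n t) →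
      (∀ t, ∑ n, b (n, t) = p t) → ‖xs - ys‖ ≤ ‖a - b‖)
    (hne : xs ≠ ys)
    (T0 : Finset (Fin T)) (hT0 : ∀ t, t ∈ T0 ↔ ∃ n, ys (n, t) > xhi n t)
    (N0 : Finset (Fin N))
    (hN0 : ∀ n, n ∈ N0 ↔ E n - ∑ t ∈ T0ᶜ, xlo n t - ∑ t ∈ T0, xhi n t < 0) :
    (∑ n ∈ N0, E n - ∑ t ∈ T0, p t + ∑ t ∈ T0, ∑ n ∈ N0ᶜ, xhi n t
        - ∑ t ∈ T0ᶜ, ∑ n ∈ N0, xlo n t < 0) ∧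
    (∑ t ∈ T0, ∑ n, xs (n, t) < ∑ t ∈ T0, p t) := by
  classical
  obtain ⟨hxE, hxb⟩ := hxsX
  have hNpos : (0:ℝ) < N := by exact_mod_cast hN
  -- squared, coordinatewise form of minimality
  have hsq : ∀ a b : Fin N → Fin T → ℝ,
      ((∀ n, ∑ t, a n t = E n) ∧ ∀ n t, xlo n t ≤ a n t ∧ a n t ≤ xhi n t) →
      (∀ t, ∑ n, b n t = p t) →
      ∑ n, ∑ t, (xs (n, t) - ys (n, t)) ^ 2 ≤ ∑ n, ∑ t, (a n t - b n t) ^ 2 := by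
    intro a b ha hb
    have h := hmin (WithLp.toLp 2 fun q => a q.1 q.2) (WithLp.toLp 2 fun q => b q.1 q.2) ha hb
    have h2 := pow_le_pow_left₀ (norm_nonneg _) h 2
    rw [EuclideanSpace.norm_sq_eq, EuclideanSpace.norm_sq_eq] at h2
    simpa [Fintype.sum_prod_type] using h2
  obtain ⟨ν, hν⟩ : ∃ ν : Fin T → ℝ, ∀ t, (N:ℝ) * ν t = p t - ∑ n, xs (n, t) :=
    ⟨fun t => (p t - ∑ n, xs (n, t)) / N, fun t => by field_simp⟩
  have hνsum : ∑ t, ν t = 0 := by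
    have : (N:ℝ) * ∑ t, ν t = 0 := by
      rw [Finset.mul_sum, Finset.sum_congr rfl (fun t _ => hν t), Finset.sum_sub_distrib, hagg1,
        Finset.sum_comm, Finset.sum_congr rfl (fun n _ => hxE n), sub_self]
    rcases mul_eq_zero.1 this with h | h
    · exact absurd h hNpos.ne'
    · exact h
  have hy : ∀ n t, ys (n, t) = xs (n, t) + ν t := by
    have h1 := hsq (fun n t => xs (n, t)) (fun n t => xs (n, t) + ν t) ⟨hxE, hxb⟩ (by
      intro t
      simp [Finset.sum_add_distrib, hν])
    have h2 : ∑ n, ∑ t, (ys (n, t) - xs (n, t) - ν t) ^ 2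
        = ∑ n, ∑ t, (xs (n, t) - ys (n, t)) ^ 2
          - ∑ n, ∑ t, (xs (n, t) - (xs (n, t) + ν t)) ^ 2 := by
      rw [Finset.sum_comm, Finset.sum_comm (f := fun n t => (xs (n, t) - ys (n, t)) ^ 2),
        Finset.sum_comm (f := fun n t => (xs (n, t) - (xs (n, t) + ν t)) ^ 2),
        ← Finset.sum_sub_distrib]
      refine Finset.sum_congr rfl fun t _ => ?_
      have e : ∑ n, (ys (n, t) - xs (n, t) - ν t) = 0 := by
        simp [Finset.sum_sub_distrib, hysY, hν]
      have e2 : ∑ n, (ys (n, t) - xs (n, t) - ν t) * (2 * ν t) = 0 := by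
        rw [← Finset.sum_mul, e, zero_mul]
      rw [← Finset.sum_sub_distrib, ← sub_eq_zero, ← Finset.sum_sub_distrib]
      rw [← neg_eq_zero, ← Finset.sum_neg_distrib, ← e2]
      refine Finset.sum_congr rfl fun n _ => ?_
      ring
    have h3 : ∑ n, ∑ t, (ys (n, t) - xs (n, t) - ν t) ^ 2 = 0 :=
      le_antisymm (by linarith)
        (Finset.sum_nonneg fun n _ => Finset.sum_nonneg fun t _ => sq_nonneg _)
    intro n t
    have h4 := (Finset.sum_eq_zero_iff_of_nonneg
      (fun n _ => Finset.sum_nonneg fun t _ => sq_nonneg _)).1 h3 n (Finset.mem_univ _)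
    have h5 := (Finset.sum_eq_zero_iff_of_nonneg
      (fun t _ => sq_nonneg _)).1 h4 t (Finset.mem_univ _)
    have h6 := pow_eq_zero_iff (two_ne_zero) |>.1 h5
    linarith
  -- exchange argument
  have hex : ∀ n s t, ν s < ν t → xs (n, s) = xlo n s ∨ xs (n, t) = xhi n t := by
    intro n s t hst
    by_contra! hcon
    have hs : 0 < xs (n, s) - xlo n s := sub_pos.2 (lt_of_le_of_ne (hxb n s).1 hcon.1.symm)
    have ht : 0 < xhi n t - xs (n, t) := sub_pos.2 (lt_of_le_of_ne (hxb n t).2 hcon.2)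
    have hne' : s ≠ t := by rintro rfl; exact lt_irrefl _ hst
    obtain ⟨ε, hε, hεs, hεt, hεν⟩ : ∃ ε : ℝ, 0 < ε ∧ ε ≤ xs (n, s) - xlo n s ∧
        ε ≤ xhi n t - xs (n, t) ∧ ε ≤ (ν t - ν s) / 2 :=
      ⟨min (xs (n, s) - xlo n s) (min (xhi n t - xs (n, t)) ((ν t - ν s) / 2)),
        lt_min hs (lt_min ht (by linarith)), min_le_left _ _,
        (min_le_right _ _).trans (min_le_left _ _), (min_le_right _ _).trans (min_le_right _ _)⟩
    let d : Fin T → ℝ := fun r => (if r = t then ε else 0) - (if r = s then ε else 0)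
    have hd0 : ∑ r, d r = 0 := by simp [d, Finset.sum_sub_distrib]
    have h := hsq (fun m r => xs (m, r) + if m = n then d r else 0) (fun m r => ys (m, r)) (by
      constructor
      · intro m
        by_cases hm : m = n
        · simp [hm, Finset.sum_add_distrib, hd0, hxE]
        · simp [hm, hxE]
      · intro m r
        have hb := hxb m r
        by_cases hm : m = n
        · subst hm
          by_cases h1 : r = t
          · subst h1
            simp only [d, if_true, if_neg hne'.symm]
            constructor <;> linarith
          · by_cases h2 : r = s
            · subst h2
              simp only [d, if_true, if_neg hne']
              constructor <;> linarith
            · simpa [d, h1, h2] using hb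
        · simpa [hm] using hb) hysY
    have e : ∑ m, ∑ r, ((xs (m, r) + if m = n then d r else 0) - ys (m, r)) ^ 2
        = ∑ m, ∑ r, (xs (m, r) - ys (m, r)) ^ 2 + ∑ r, (d r ^ 2 - 2 * ν r * d r) := by
      have : ∑ r, (d r ^ 2 - 2 * ν r * d r)
          = ∑ m, if m = n then ∑ r, (d r ^ 2 - 2 * ν r * d r) else 0 := by simp
      rw [this, ← Finset.sum_add_distrib]
      refine Finset.sum_congr rfl fun m _ => ?_
      by_cases hm : m = n
      · simp only [hm, if_true]
        rw [← Finset.sum_add_distrib]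
        refine Finset.sum_congr rfl fun r _ => ?_
        rw [hy]; ring
      · simp [hm]
    have e2 : ∑ r, (d r ^ 2 - 2 * ν r * d r) = 2 * ε ^ 2 - 2 * ε * (ν t - ν s) := by
      have : ∀ r, d r ^ 2 - 2 * ν r * d r
          = (if r = t then ε ^ 2 - 2 * ε * ν r else 0)
            + (if r = s then ε ^ 2 + 2 * ε * ν r else 0) := by
        intro r
        by_cases h1 : r = t
        · subst h1
          simp only [d, if_true, if_neg hne'.symm]; ring
        · by_cases h2 : r = s
          · subst h2
            simp only [d, if_true, if_neg hne']; ring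
          · simp [d, h1, h2]
      rw [Finset.sum_congr rfl fun r _ => this r, Finset.sum_add_distrib]
      simp
      ring
    simp only [e, e2] at h
    nlinarith
  have hT0' : ∀ t, t ∈ T0 ↔ 0 < ν t := by
    intro t
    rw [hT0]
    constructor
    · rintro ⟨n, hn⟩
      rw [hy] at hn
      linarith [(hxb n t).2]
    · intro ht
      by_contra! hcon
      have hall : ∀ s, 0 ≤ ν s := by
        intro s
        by_contra! hs
        have hlo : ∀ n, xs (n, s) = xlo n s := by
          intro n
          rcases hex n s t (by linarith) with h | h
          · exact h
          · have := hcon n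
            rw [hy] at this
            linarith
        have := hν s
        rw [Finset.sum_congr rfl fun n _ => hlo n] at this
        nlinarith [(hagg2 s).1]
      have := (Finset.sum_eq_zero_iff_of_nonneg (fun s _ => hall s)).1 hνsum t (Finset.mem_univ _)
      linarith
  have hne0 : T0.Nonempty := by
    by_contra hemp
    have hle : ∀ t, ν t ≤ 0 := fun t => by
      by_contra! h
      exact hemp ⟨t, (hT0' t).2 h⟩
    have hz := (Finset.sum_eq_zero_iff_of_nonpos (fun s _ => hle s)).1 hνsum
    apply hne
    ext ⟨n, t⟩
    rw [hy, hz t (Finset.mem_univ _), add_zero]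
  have hsecond : ∑ t ∈ T0, ∑ n, xs (n, t) < ∑ t ∈ T0, p t := by
    refine Finset.sum_lt_sum_of_nonempty hne0 fun t ht => ?_
    have := mul_pos hNpos ((hT0' t).1 ht)
    rw [hν] at this
    linarith
  have hdich : ∀ n, (∀ s ∈ T0ᶜ, xs (n, s) = xlo n s) ∨ (∀ t ∈ T0, xs (n, t) = xhi n t) := by
    intro n
    by_contra! hcon
    obtain ⟨⟨s, hs, hs'⟩, t, ht, ht'⟩ := hcon
    have h1 := (hT0' t).1 ht
    have h2 : ν s ≤ 0 := by
      by_contra! h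
      exact (Finset.mem_compl.1 hs) ((hT0' s).2 h)
    rcases hex n s t (by linarith) with h | h
    · exact hs' h
    · exact ht' h
  have hEsplit : ∀ n, E n = ∑ t ∈ T0, xs (n, t) + ∑ t ∈ T0ᶜ, xs (n, t) := fun n => by
    rw [Finset.sum_add_sum_compl, hxE]
  have hin : ∀ n ∈ N0, E n - ∑ t ∈ T0ᶜ, xlo n t = ∑ t ∈ T0, xs (n, t) := by
    intro n hn
    rcases hdich n with h | h
    · rw [hEsplit n, Finset.sum_congr rfl h]; ring
    · have h1 := (hN0 n).1 hn
      have h2 : ∑ t ∈ T0ᶜ, xlo n t ≤ ∑ t ∈ T0ᶜ, xs (n, t) :=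
        Finset.sum_le_sum fun t _ => (hxb n t).1
      rw [hEsplit n, Finset.sum_congr rfl h] at h1
      linarith
  have hout : ∀ n ∈ N0ᶜ, ∑ t ∈ T0, xhi n t = ∑ t ∈ T0, xs (n, t) := by
    intro n hn
    have h1 : ¬ _ := fun h => (Finset.mem_compl.1 hn) ((hN0 n).2 h)
    rcases hdich n with h | h
    · rw [hEsplit n, Finset.sum_congr rfl h] at h1
      have h2 : ∑ t ∈ T0, xs (n, t) ≤ ∑ t ∈ T0, xhi n t :=
        Finset.sum_le_sum fun t _ => (hxb n t).2
      linarith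
    · exact (Finset.sum_congr rfl h).symm
  refine ⟨?_, hsecond⟩
  have key : ∑ n ∈ N0, E n + ∑ t ∈ T0, ∑ n ∈ N0ᶜ, xhi n t - ∑ t ∈ T0ᶜ, ∑ n ∈ N0, xlo n t
      = ∑ t ∈ T0, ∑ n, xs (n, t) := by
    rw [Finset.sum_comm (s := T0) (t := N0ᶜ), Finset.sum_comm (s := T0ᶜ) (t := N0),
      Finset.sum_comm (s := T0), Finset.sum_congr rfl hout, ← Finset.sum_add_sum_compl N0,
      ← Finset.sum_congr rfl hin, Finset.sum_sub_distrib]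
    ring
  linarith
end

section
/- Assume the aggregate conditions and the individual feasibility conditions. Let (x∞, y∞) ∈ X × Y achieve the minimum of ‖x − y‖ over X × Y, with x∞ ≠ y∞, and define T0 = {t | ∃ n, y∞ n t > xhi n t} and N0 = {n | E n − ∑_{t ∉ T0} xlo n t − ∑_{t ∈ T0} xhi n t < 0}. Then: for every t ∈ T0 and every n ∉ N0, x∞ n t = xhi n t and y∞ n t > xhi n t; and for every t ∉ T0 and every n ∈ N0, x∞ n t = xlo n t. -/
lemma cut_first_order {ι : Type*} [Fintype ι] [DecidableEq ι] (z : EuclideanSpace ℝ ι) (i j : ι)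
    (e0 : ℝ) (he0 : 0 < e0)
    (h : ∀ e : ℝ, 0 < e → e ≤ e0 →
      ‖z‖ ≤ ‖z + e • (EuclideanSpace.single i (1:ℝ) - EuclideanSpace.single j (1:ℝ))‖) :
    z j ≤ z i := by
  set w : EuclideanSpace ℝ ι :=
    EuclideanSpace.single i (1:ℝ) - EuclideanSpace.single j (1:ℝ) with hw
  have hin : inner ℝ z w = z i - z j := by
    rw [hw, inner_sub_right, EuclideanSpace.inner_single_right, EuclideanSpace.inner_single_right]
    simp
  by_contra hlt
  push Not at hlt
  have key : ∀ e : ℝ, 0 < e → e ≤ e0 → 0 ≤ 2 * (z i - z j) + e * ‖w‖ ^ 2 := by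
    intro e he hle
    have h1 := h e he hle
    have h2 : ‖z‖ ^ 2 ≤ ‖z + e • w‖ ^ 2 := by gcongr
    rw [norm_add_sq_real, inner_smul_right, hin, norm_smul, mul_pow, Real.norm_eq_abs, sq_abs] at h2
    have h3 : 0 ≤ e * (2 * (z i - z j) + e * ‖w‖ ^ 2) := by nlinarith
    exact nonneg_of_mul_nonneg_right h3 he
  have hd : 0 < z j - z i := by linarith
  have hW : 0 < ‖w‖ ^ 2 + 1 := by positivity
  have hpos : 0 < min e0 ((z j - z i) / (‖w‖ ^ 2 + 1)) := lt_min he0 (by positivity)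
  have h4 := key _ hpos (min_le_left _ _)
  have h5 : min e0 ((z j - z i) / (‖w‖ ^ 2 + 1)) * (‖w‖ ^ 2 + 1) ≤ z j - z i := by
    rw [← le_div_iff₀ hW]
    exact min_le_right _ _
  nlinarith

/-- Structural properties of the optimal orbit of alternate projections: with `T0, N0`
built from the limit pair `(xs, ys)`, every agent outside `N0` is at its upper bound on
`T0` (and `ys` strictly exceeds the upper bound there), and every agent in `N0` is at
its lower bound outside `T0`. -/
theorem facts_on_cut
    (N T : ℕ) (hN : 1 ≤ N) (hT : 1 ≤ T)
    (E : Fin N → ℝ) (xlo xhi : Fin N → Fin T → ℝ) (p : Fin T → ℝ)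
    (hagg1 : ∑ t, p t = ∑ n, E n)
    (hagg2 : ∀ t, ∑ n, xlo n t ≤ p t ∧ p t ≤ ∑ n, xhi n t)
    (hfeas1 : ∀ n t, xlo n t ≤ xhi n t)
    (hfeas2 : ∀ n, ∑ t, xlo n t ≤ E n ∧ E n ≤ ∑ t, xhi n t)
    (xs ys : EuclideanSpace ℝ (Fin N × Fin T))
    (hxsX : (∀ n, ∑ t, xs (n, t) = E n) ∧ ∀ n t, xlo n t ≤ xs (n, t) ∧ xs (n, t) ≤ xhi n t)
    (hysY : ∀ t, ∑ n, ys (n, t) = p t)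
    (hmin : ∀ a b : EuclideanSpace ℝ (Fin N × Fin T),
      ((∀ n, ∑ t, a (n, t) = E n) ∧ ∀ n t, xlo n t ≤ a (n, t) ∧ a (n, t) ≤ xhi n t) →
      (∀ t, ∑ n, b (n, t) = p t) → ‖xs - ys‖ ≤ ‖a - b‖)
    (hne : xs ≠ ys)
    (T0 : Finset (Fin T)) (hT0 : ∀ t, t ∈ T0 ↔ ∃ n, ys (n, t) > xhi n t)
    (N0 : Finset (Fin N))
    (hN0 : ∀ n, n ∈ N0 ↔ E n - ∑ t ∈ T0ᶜ, xlo n t - ∑ t ∈ T0, xhi n t < 0) :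
    (∀ t ∈ T0, ∀ n ∉ N0, xs (n, t) = xhi n t ∧ ys (n, t) > xhi n t) ∧
    (∀ t ∉ T0, ∀ n ∈ N0, xs (n, t) = xlo n t) := by
  have hY : ∀ n m t, (xs - ys) (m, t) ≤ (xs - ys) (n, t) := by
    intro n m t
    refine cut_first_order (xs - ys) (n, t) (m, t) 1 one_pos ?_
    intro e he hle
    have := hmin xs (ys - e • (EuclideanSpace.single (n, t) (1:ℝ) -
      EuclideanSpace.single (m, t) (1:ℝ))) hxsX ?_
    · rwa [sub_sub_eq_add_sub, add_sub_right_comm] at this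
    · intro r
      rw [← hysY r]
      by_cases hr : r = t
      · subst hr
        simp [Finset.sum_sub_distrib, mul_sub, Pi.single_apply, Prod.ext_iff, ← Finset.mul_sum]
      · simp [Pi.single_apply, Prod.ext_iff, hr]
  have hX : ∀ n s t, xs (n, s) < xhi n s → xlo n t < xs (n, t) →
      ys (n, s) - xs (n, s) ≤ ys (n, t) - xs (n, t) := by
    intro n s t hs ht
    by_cases hst : s = t
    · subst hst; exact le_rfl
    have hkey : (xs - ys) (n, t) ≤ (xs - ys) (n, s) := by
      refine cut_first_order (xs - ys) (n, s) (n, t)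
        (min (xhi n s - xs (n, s)) (xs (n, t) - xlo n t))
        (lt_min (by linarith) (by linarith)) ?_
      intro e he hle
      have hl1 := hle.trans (min_le_left _ _)
      have hl2 := hle.trans (min_le_right _ _)
      have := hmin (xs + e • (EuclideanSpace.single (n, s) (1:ℝ) -
        EuclideanSpace.single (n, t) (1:ℝ))) ys ⟨?_, ?_⟩ hysY
      · rwa [add_sub_right_comm] at this
      · intro m
        rw [← hxsX.1 m]
        by_cases hm : m = n
        · subst hm
          simp [Finset.sum_add_distrib, mul_sub, Pi.single_apply, Prod.ext_iff]
        · simp [Pi.single_apply, Prod.ext_iff, hm]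
      · intro m r
        have hb := hxsX.2 m r
        by_cases hm : m = n
        · subst hm
          by_cases hrs : r = s
          · subst hrs
            simp [Pi.single_apply, hst]
            constructor <;> linarith
          · by_cases hrt : r = t
            · subst hrt
              simp [Pi.single_apply, hrs]
              constructor <;> linarith
            · simpa [Pi.single_apply, hrs, hrt] using hb
        · simpa [Pi.single_apply, hm] using hb
    simp only [PiLp.sub_apply] at hkey
    linarith
  have hd : ∀ n m t, ys (m, t) - xs (m, t) = ys (n, t) - xs (n, t) := by
    intro n m t
    have h1 := hY n m t
    have h2 := hY m n t
    simp only [PiLp.sub_apply] at h1 h2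
    linarith
  have hpos : ∀ t ∈ T0, ∀ n, 0 < ys (n, t) - xs (n, t) := by
    intro t ht n
    obtain ⟨m, hm⟩ := (hT0 t).1 ht
    have := (hxsX.2 m t).2
    rw [hd m n t]
    linarith
  have htot : ∑ t, ∑ n, (ys (n, t) - xs (n, t)) = 0 := by
    simp only [Finset.sum_sub_distrib, hysY]
    rw [Finset.sum_comm, hagg1]
    simp [hxsX.1]
  have hneg : ∀ s ∉ T0, ∀ n, ys (n, s) - xs (n, s) ≤ 0 := by
    intro s hs n
    by_contra hc
    push Not at hc
    have hlt : ∀ m, xs (m, s) < xhi m s := by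
      intro m
      have h1 : ¬ ys (m, s) > xhi m s := fun h => hs ((hT0 s).2 ⟨m, h⟩)
      have h2 := hd n m s
      linarith
    have hall : ∀ r m, 0 ≤ ys (m, r) - xs (m, r) := by
      intro r m
      by_contra hr
      push Not at hr
      have heq : ∀ k, xs (k, r) = xlo k r := by
        intro k
        by_contra hk
        have h1 := hX k s r (hlt k) (lt_of_le_of_ne (hxsX.2 k r).1 (Ne.symm hk))
        have h2 := hd n k s
        have h3 := hd m k r
        linarith
      have h4 : ∑ k, ys (k, r) < ∑ k, xlo k r := by
        apply Finset.sum_lt_sum_of_nonempty ⟨n, Finset.mem_univ n⟩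
        intro k _
        have h3 := hd m k r
        have := heq k
        linarith
      have := (hagg2 r).1
      rw [hysY] at h4
      linarith
    have : 0 < ∑ t, ∑ n, (ys (n, t) - xs (n, t)) :=
      Finset.sum_pos' (fun t _ => Finset.sum_nonneg fun k _ => hall t k)
        ⟨s, Finset.mem_univ s, Finset.sum_pos' (fun k _ => hall s k) ⟨n, Finset.mem_univ n, hc⟩⟩
    linarith
  have hsplit : ∀ n, ∑ t ∈ T0, xs (n, t) + ∑ t ∈ T0ᶜ, xs (n, t) = E n := by
    intro n
    rw [Finset.sum_add_sum_compl, hxsX.1]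
  constructor
  · intro t ht n hn
    have hx : xs (n, t) = xhi n t := by
      by_contra hne'
      have hlt := lt_of_le_of_ne (hxsX.2 n t).2 hne'
      have h1 : ∑ r ∈ T0, xs (n, r) < ∑ r ∈ T0, xhi n r :=
        Finset.sum_lt_sum (fun r _ => (hxsX.2 n r).2) ⟨t, ht, hlt⟩
      have h2 : ∑ r ∈ T0ᶜ, xlo n r < ∑ r ∈ T0ᶜ, xs (n, r) := by
        rw [hN0] at hn
        have := hsplit n
        linarith
      obtain ⟨s, hs, hslt⟩ := Finset.exists_lt_of_sum_lt h2
      have h3 := hX n t s hlt hslt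
      have h4 := hneg s (Finset.mem_compl.1 hs) n
      have h5 := hpos t ht n
      linarith
    refine ⟨hx, ?_⟩
    have := hpos t ht n
    linarith
  · intro t ht n hn
    by_contra hne'
    have hlt := lt_of_le_of_ne (hxsX.2 n t).1 (Ne.symm hne')
    have h1 : ∑ r ∈ T0ᶜ, xlo n r < ∑ r ∈ T0ᶜ, xs (n, r) :=
      Finset.sum_lt_sum (fun r _ => (hxsX.2 n r).1) ⟨t, Finset.mem_compl.2 ht, hlt⟩
    have h2 : ∑ r ∈ T0, xs (n, r) < ∑ r ∈ T0, xhi n r := by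
      rw [hN0] at hn
      have := hsplit n
      linarith
    obtain ⟨s, hs, hslt⟩ := Finset.exists_lt_of_sum_lt h2
    have h3 := hX n s t hslt hlt
    have h4 := hneg t ht n
    have h5 := hpos s hs n
    linarith
end

section
/- Assume the aggregate conditions and the individual feasibility conditions. Let (x∞, y∞) ∈ X × Y achieve the minimum of ‖x − y‖ over X × Y, with x∞ ≠ y∞, and define T0 = {t | ∃ n, y∞ n t > xhi n t}. Then T0 = {t | p t > ∑_{n} x∞ n t}. -/
/-- The set `T0` of time periods where `ys` exceeds some upper bound coincides with
the set of time periods where the allocation `p` strictly exceeds the aggregate of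
the limit profile `xs`. -/
theorem T0_eq_oversupply_set
    (N T : ℕ) (hN : 1 ≤ N) (hT : 1 ≤ T)
    (E : Fin N → ℝ) (xlo xhi : Fin N → Fin T → ℝ) (p : Fin T → ℝ)
    (hagg1 : ∑ t, p t = ∑ n, E n)
    (hagg2 : ∀ t, ∑ n, xlo n t ≤ p t ∧ p t ≤ ∑ n, xhi n t)
    (hfeas1 : ∀ n t, xlo n t ≤ xhi n t)
    (hfeas2 : ∀ n, ∑ t, xlo n t ≤ E n ∧ E n ≤ ∑ t, xhi n t)
    (xs ys : EuclideanSpace ℝ (Fin N × Fin T))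
    (hxsX : (∀ n, ∑ t, xs (n, t) = E n) ∧ ∀ n t, xlo n t ≤ xs (n, t) ∧ xs (n, t) ≤ xhi n t)
    (hysY : ∀ t, ∑ n, ys (n, t) = p t)
    (hmin : ∀ a b : EuclideanSpace ℝ (Fin N × Fin T),
      ((∀ n, ∑ t, a (n, t) = E n) ∧ ∀ n t, xlo n t ≤ a (n, t) ∧ a (n, t) ≤ xhi n t) →
      (∀ t, ∑ n, b (n, t) = p t) → ‖xs - ys‖ ≤ ‖a - b‖)
    (hne : xs ≠ ys)
    (T0 : Finset (Fin T)) (hT0 : ∀ t, t ∈ T0 ↔ ∃ n, ys (n, t) > xhi n t)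
    :
    ∀ t, t ∈ T0 ↔ p t > ∑ n, xs (n, t) := by
  have hN0 : (N : ℝ) ≠ 0 := by positivity
  have nsq : ∀ a b : EuclideanSpace ℝ (Fin N × Fin T),
      ‖a - b‖ ^ 2 = ∑ q, (a q - b q) ^ 2 := by
    intro a b
    rw [EuclideanSpace.norm_sq_eq]
    simp
  have hminsq : ∀ a b : EuclideanSpace ℝ (Fin N × Fin T),
      ((∀ n, ∑ t, a (n, t) = E n) ∧ ∀ n t, xlo n t ≤ a (n, t) ∧ a (n, t) ≤ xhi n t) →
      (∀ t, ∑ n, b (n, t) = p t) → ∑ q, (xs q - ys q) ^ 2 ≤ ∑ q, (a q - b q) ^ 2 := by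
    intro a b ha hb
    rw [← nsq, ← nsq]
    exact pow_le_pow_left₀ (norm_nonneg _) (hmin a b ha hb) 2
  obtain ⟨d, hd⟩ : ∃ d : Fin T → ℝ, ∀ t, (N : ℝ) * d t = p t - ∑ n, xs (n, t) :=
    ⟨fun t => (p t - ∑ n, xs (n, t)) / N, fun t => by field_simp⟩
  -- the profile `ys` is the projection of `xs` on `Y`
  have hy : ∀ n t, ys (n, t) = xs (n, t) + d t := by
    have h1 := hminsq xs (WithLp.toLp 2 fun q => xs q + d q.2) hxsX (by
      intro t
      simp [Finset.sum_add_distrib, hd])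
    have h2 : ∑ q : Fin N × Fin T, (ys q - xs q - d q.2) ^ 2
        = ∑ q, (xs q - ys q) ^ 2 - ∑ q : Fin N × Fin T, (d q.2) ^ 2 := by
      have h3 : ∑ q : Fin N × Fin T, d q.2 * (ys q - xs q)
          = ∑ q : Fin N × Fin T, (d q.2) ^ 2 := by
        rw [Fintype.sum_prod_type_right, Fintype.sum_prod_type_right]
        refine Finset.sum_congr rfl fun t _ => ?_
        simp only [← Finset.mul_sum, Finset.sum_sub_distrib, hysY, ← hd]
        simp
        ring
      have h4 : ∑ q : Fin N × Fin T, (ys q - xs q - d q.2) ^ 2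
        = ∑ q, (xs q - ys q) ^ 2 - 2 * ∑ q : Fin N × Fin T, d q.2 * (ys q - xs q)
          + ∑ q : Fin N × Fin T, (d q.2) ^ 2 := by
        rw [Finset.mul_sum, ← Finset.sum_sub_distrib, ← Finset.sum_add_distrib]
        exact Finset.sum_congr rfl fun q _ => by ring
      rw [h4, h3]; ring
    have h5 : ∑ q : Fin N × Fin T, (ys q - xs q - d q.2) ^ 2 = 0 := by
      refine le_antisymm ?_ (Finset.sum_nonneg fun q _ => sq_nonneg _)
      rw [h2]
      simp at h1
      linarith
    rw [Finset.sum_eq_zero_iff_of_nonneg (fun q _ => sq_nonneg _)] at h5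
    intro n t
    have := pow_eq_zero_iff (two_ne_zero) |>.1 (h5 (n, t) (Finset.mem_univ _))
    simp at this
    linarith
  have hNpos : (0 : ℝ) < N := by positivity
  -- exchange argument
  have hex : ∀ n t s, xs (n, t) < xhi n t → xlo n s < xs (n, s) → d t ≤ d s := by
    intro n t s h1 h2
    by_contra! hlt
    have hts : t ≠ s := by rintro rfl; exact lt_irrefl _ hlt
    obtain ⟨ε, hε, he1, he2, he3⟩ : ∃ ε : ℝ, 0 < ε ∧ ε ≤ xhi n t - xs (n, t) ∧
        ε ≤ xs (n, s) - xlo n s ∧ ε ≤ (d t - d s) / 2 :=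
      ⟨min (xhi n t - xs (n, t)) (min (xs (n, s) - xlo n s) ((d t - d s) / 2)),
        lt_min (by linarith) (lt_min (by linarith) (by linarith)),
        min_le_left _ _, (min_le_right _ _).trans (min_le_left _ _),
        (min_le_right _ _).trans (min_le_right _ _)⟩
    let v : Fin N × Fin T → ℝ := fun q =>
      (if q = (n, t) then 1 else 0) - (if q = (n, s) then 1 else 0)
    have h3 := hminsq (WithLp.toLp 2 fun q => xs q + ε * v q) ys (by
      constructor
      · intro m
        have : ∑ u, v (m, u) = 0 := by
          by_cases hm : m = n <;> simp [v, hm]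
        simp [Finset.sum_add_distrib, ← Finset.mul_sum, this, hxsX.1]
      · intro m u
        have hb := hxsX.2 m u
        by_cases hm : m = n
        · subst hm
          by_cases hu : u = t
          · subst hu
            simp [v, hts]
            constructor <;> linarith
          · by_cases hu' : u = s
            · subst hu'
              simp [v, hu]
              constructor <;> linarith
            · simpa [v, hu, hu'] using hb
        · simpa [v, hm] using hb) hysY
    have h4 : ∑ q, (xs q + ε * v q - ys q) ^ 2 = ∑ q, (xs q - ys q) ^ 2
        + (2 * ε * ∑ q, (xs q - ys q) * v q + ε ^ 2 * ∑ q, v q ^ 2) := by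
      rw [Finset.mul_sum, Finset.mul_sum, ← Finset.sum_add_distrib, ← Finset.sum_add_distrib]
      exact Finset.sum_congr rfl fun q _ => by ring
    have h5 : ∑ q, (xs q - ys q) * v q = d s - d t := by
      simp [v, mul_sub, Finset.sum_sub_distrib, hy]
      ring
    have h6 : ∑ q, v q ^ 2 = 2 := by
      have : ∀ q, v q ^ 2 = (if q = (n, t) then 1 else 0) + (if q = (n, s) then 1 else 0) := by
        intro q
        by_cases hq : q = (n, t)
        · subst hq; simp [v, hts]
        · by_cases hq' : q = (n, s) <;> simp [v, hq, hq', hts.symm]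
      simp only [this, Finset.sum_add_distrib]
      simp
      norm_num
    simp only [h4, h5, h6] at h3
    nlinarith
  have hsum : ∑ t, d t = 0 := by
    have h1 : (N : ℝ) * ∑ t, d t = 0 := by
      rw [Finset.mul_sum]
      simp only [hd, Finset.sum_sub_distrib]
      rw [Finset.sum_comm, hagg1]
      simp [hxsX.1]
    exact (mul_eq_zero.1 h1).resolve_left hN0
  intro t
  rw [hT0]
  constructor
  · rintro ⟨n, hn⟩
    have h1 := (hxsX.2 n t).2
    have h2 := hy n t
    have h3 : 0 < d t := by linarith
    have h4 := mul_pos hNpos h3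
    rw [hd] at h4
    linarith
  · intro ht
    by_contra! hcon
    have hdt : 0 < d t := by
      have : 0 < (N : ℝ) * d t := by rw [hd]; linarith
      exact pos_of_mul_pos_right this hNpos.le
    have hnn : ∀ s, 0 ≤ d s := by
      intro s
      by_contra! hs
      have h1 : ∀ n, xs (n, s) ≤ xlo n s := by
        intro n
        by_contra! h
        have h2 := hcon n
        rw [hy] at h2
        have := hex n t s (by linarith) h
        linarith
      have h2 : ∑ n, xs (n, s) ≤ ∑ n, xlo n s := Finset.sum_le_sum fun n _ => h1 n
      have h3 := (hagg2 s).1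
      have h4 := mul_neg_of_pos_of_neg hNpos hs
      rw [hd] at h4
      linarith
    have := Finset.sum_pos' (fun s _ => hnn s) ⟨t, Finset.mem_univ _, hdt⟩
    linarith
end

section
/- Assume the aggregate conditions and the individual feasibility conditions. Let (x∞, y∞) ∈ X × Y achieve the minimum of ‖x − y‖ over X × Y, with x∞ ≠ y∞, and define T0 = {t | ∃ n, y∞ n t > xhi n t} and N0 = {n | E n − ∑_{t ∉ T0} xlo n t − ∑_{t ∈ T0} xhi n t < 0}. Then T0 is nonempty and a proper subset of Fin T, and N0 is nonempty and a proper subset of Fin N. -/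
lemma perturb_aux {ι : Type*} [Fintype ι] [DecidableEq ι] (w : EuclideanSpace ℝ ι) (i j : ι)
    (hij : i ≠ j) (e : ℝ)
    (h : ‖w‖ ≤ ‖w + e • (EuclideanSpace.single i (1 : ℝ) - EuclideanSpace.single j (1 : ℝ))‖) :
    0 ≤ e * (w i - w j) + e ^ 2 := by
  have h2 : ‖w‖ ^ 2 ≤
      ‖w + e • (EuclideanSpace.single i (1 : ℝ) - EuclideanSpace.single j (1 : ℝ))‖ ^ 2 := by
    gcongr
  rw [norm_add_sq_real, inner_smul_right, inner_sub_right, norm_smul, mul_pow,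
    norm_sub_sq_real] at h2
  simp [EuclideanSpace.inner_single_right, hij, hij.symm] at h2
  nlinarith

/-- The sets `T0` and `N0` constructed from the optimal orbit of alternate projections
are nonempty proper subsets of `Fin T` and `Fin N` respectively. -/
theorem T0_N0_nonempty_proper
    (N T : ℕ) (hN : 1 ≤ N) (hT : 1 ≤ T)
    (E : Fin N → ℝ) (xlo xhi : Fin N → Fin T → ℝ) (p : Fin T → ℝ)
    (hagg1 : ∑ t, p t = ∑ n, E n)
    (hagg2 : ∀ t, ∑ n, xlo n t ≤ p t ∧ p t ≤ ∑ n, xhi n t)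
    (hfeas1 : ∀ n t, xlo n t ≤ xhi n t)
    (hfeas2 : ∀ n, ∑ t, xlo n t ≤ E n ∧ E n ≤ ∑ t, xhi n t)
    (xs ys : EuclideanSpace ℝ (Fin N × Fin T))
    (hxsX : (∀ n, ∑ t, xs (n, t) = E n) ∧ ∀ n t, xlo n t ≤ xs (n, t) ∧ xs (n, t) ≤ xhi n t)
    (hysY : ∀ t, ∑ n, ys (n, t) = p t)
    (hmin : ∀ a b : EuclideanSpace ℝ (Fin N × Fin T),
      ((∀ n, ∑ t, a (n, t) = E n) ∧ ∀ n t, xlo n t ≤ a (n, t) ∧ a (n, t) ≤ xhi n t) →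
      (∀ t, ∑ n, b (n, t) = p t) → ‖xs - ys‖ ≤ ‖a - b‖)
    (hne : xs ≠ ys)
    (T0 : Finset (Fin T)) (hT0 : ∀ t, t ∈ T0 ↔ ∃ n, ys (n, t) > xhi n t)
    (N0 : Finset (Fin N))
    (hN0 : ∀ n, n ∈ N0 ↔ E n - ∑ t ∈ T0ᶜ, xlo n t - ∑ t ∈ T0, xhi n t < 0) :
    T0.Nonempty ∧ T0 ≠ Finset.univ ∧ N0.Nonempty ∧ N0 ≠ Finset.univ := by
  classical
  obtain ⟨hsum, hbd⟩ := hxsX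
  -- the gap is independent of the agent
  have hgap : ∀ t n m, ys (n, t) - xs (n, t) = ys (m, t) - xs (m, t) := by
    intro t n m
    by_cases hnm : n = m
    · rw [hnm]
    have key : ∀ e : ℝ, 0 ≤ e * ((xs - ys) (n, t) - (xs - ys) (m, t)) + e ^ 2 := by
      intro e
      apply perturb_aux (xs - ys) (n, t) (m, t) (by simp [hnm])
      have := hmin xs (ys - e • (EuclideanSpace.single (n, t) (1 : ℝ)
        - EuclideanSpace.single (m, t) (1 : ℝ))) ⟨hsum, hbd⟩ ?_
      · rwa [show xs - (ys - e • (EuclideanSpace.single (n, t) (1 : ℝ)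
          - EuclideanSpace.single (m, t) (1 : ℝ))) = xs - ys + e •
          (EuclideanSpace.single (n, t) (1 : ℝ) - EuclideanSpace.single (m, t) (1 : ℝ)) by
          abel] at this
      · intro t'
        rw [← hysY t']
        by_cases htt : t' = t <;>
        simp [Finset.sum_sub_distrib, Pi.single_apply, ← Finset.mul_sum, htt]
    have h1 := key (-((xs - ys) (n, t) - (xs - ys) (m, t)) / 2)
    simp only [PiLp.sub_apply] at h1
    nlinarith [sq_nonneg ((xs (n, t) - ys (n, t)) - (xs (m, t) - ys (m, t)))]
  let n0 : Fin N := ⟨0, hN⟩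
  obtain ⟨δ, hδ⟩ : ∃ δ : Fin T → ℝ, ∀ n t, ys (n, t) = xs (n, t) + δ t :=
    ⟨fun t => ys (n0, t) - xs (n0, t), fun n t => by have := hgap t n n0; linarith⟩
  -- exchange property
  have hkkt : ∀ n s t, δ t < δ s → xs (n, s) < xhi n s → xs (n, t) = xlo n t := by
    intro n s t hts hs
    by_contra hne'
    have ht : xlo n t < xs (n, t) := lt_of_le_of_ne (hbd n t).1 (Ne.symm hne')
    have hst : s ≠ t := by rintro rfl; exact lt_irrefl _ hts
    obtain ⟨e, he, he1, he2, he3⟩ : ∃ e : ℝ, 0 < e ∧ e < xhi n s - xs (n, s) ∧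
        e < xs (n, t) - xlo n t ∧ e < δ s - δ t := by
      obtain ⟨e, he, h⟩ := exists_between (show 0 < min (xhi n s - xs (n, s))
        (min (xs (n, t) - xlo n t) (δ s - δ t)) by
          simp only [lt_min_iff]; refine ⟨?_, ?_, ?_⟩ <;> linarith)
      simp only [lt_min_iff] at h
      exact ⟨e, he, h⟩
    have key := perturb_aux (xs - ys) (n, s) (n, t) (by simp [hst]) e (by
      have := hmin (xs + e • (EuclideanSpace.single (n, s) (1 : ℝ)
        - EuclideanSpace.single (n, t) (1 : ℝ))) ys ⟨?_, ?_⟩ hysY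
      · rwa [add_sub_right_comm] at this
      · intro m
        rw [← hsum m]
        by_cases hm : m = n <;>
        simp [Finset.sum_add_distrib, Finset.sum_sub_distrib, Pi.single_apply, ← Finset.mul_sum, hm]
      · intro m r
        have := hbd m r
        by_cases hm : m = n
        · subst hm
          by_cases h1 : r = s
          · subst h1
            simp [hst]; constructor <;> linarith
          · by_cases h2 : r = t
            · subst h2
              simp [h1]; constructor <;> linarith
            · simpa [h1, h2] using this
        · simpa [hm] using this)
    simp only [PiLp.sub_apply, hδ] at key
    nlinarith
  have hp : ∀ t, p t = ∑ n, xs (n, t) + N * δ t := by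
    intro t
    rw [← hysY t]
    simp [hδ, Finset.sum_add_distrib]
  have hNpos : (0 : ℝ) < N := by exact_mod_cast hN
  have hδsum : ∑ t, δ t = 0 := by
    have h1 : ∑ t, p t = ∑ n, E n + N * ∑ t, δ t := by
      simp only [hp, Finset.sum_add_distrib, ← Finset.mul_sum, ← hsum]
      rw [Finset.sum_comm]
    have : (N : ℝ) * ∑ t, δ t = 0 := by linarith
    exact (mul_eq_zero.mp this).resolve_left hNpos.ne'
  have hδne : ∃ t ∈ (Finset.univ : Finset (Fin T)), δ t ≠ 0 := by
    by_contra! h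
    apply hne
    ext ⟨n, t⟩
    simp [hδ, h t (Finset.mem_univ _)]
  obtain ⟨tp, -, htp⟩ := Finset.exists_pos_of_sum_zero_of_exists_nonzero _ hδsum hδne
  obtain ⟨tm, htm⟩ : ∃ t, δ t < 0 := by
    obtain ⟨t, -, ht⟩ := Finset.exists_pos_of_sum_zero_of_exists_nonzero (fun t => - δ t)
      (s := Finset.univ) (by simp [hδsum]) (by simpa using hδne)
    exact ⟨t, by linarith⟩
  have hlow : ¬ ∀ n, xs (n, tm) = xlo n tm := by
    intro h
    have h1 := (hagg2 tm).1
    rw [hp tm] at h1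
    simp only [h] at h1
    nlinarith
  have hmem : ∀ t, t ∈ T0 ↔ 0 < δ t := by
    intro t
    rw [hT0]
    constructor
    · rintro ⟨n, hn⟩
      have := (hbd n t).2
      rw [hδ] at hn
      linarith
    · intro h
      by_contra! h'
      apply hlow
      intro n
      apply hkkt n t tm (by linarith)
      have := h' n
      rw [hδ] at this
      linarith
  have htm' : tm ∉ T0 := by rw [hmem]; linarith
  have hEs : ∀ n, E n = ∑ t ∈ T0ᶜ, xs (n, t) + ∑ t ∈ T0, xs (n, t) := by
    intro n
    rw [← hsum n, Finset.sum_compl_add_sum]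
  refine ⟨⟨tp, (hmem tp).2 htp⟩, fun h => htm' (h ▸ Finset.mem_univ _), ?_, ?_⟩
  · by_contra hempty
    rw [Finset.not_nonempty_iff_eq_empty] at hempty
    have hhi : ∀ n, xs (n, tp) = xhi n tp := by
      intro n
      by_contra hlt
      have hlt : xs (n, tp) < xhi n tp := lt_of_le_of_ne (hbd n tp).2 hlt
      have hn : n ∈ N0 := by
        rw [hN0, hEs]
        have h1 : ∑ t ∈ T0ᶜ, xs (n, t) = ∑ t ∈ T0ᶜ, xlo n t := by
          apply Finset.sum_congr rfl
          intro s hs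
          rw [Finset.mem_compl, hmem] at hs
          exact hkkt n tp s (by linarith) hlt
        have h2 : ∑ t ∈ T0, xs (n, t) < ∑ t ∈ T0, xhi n t :=
          Finset.sum_lt_sum (fun t _ => (hbd n t).2) ⟨tp, (hmem tp).2 htp, hlt⟩
        linarith
      simp [hempty] at hn
    have h1 := (hagg2 tp).2
    rw [hp tp] at h1
    simp only [hhi] at h1
    nlinarith
  · intro huniv
    apply hlow
    intro n
    by_contra hgt
    have hn : n ∈ N0 := huniv ▸ Finset.mem_univ n
    rw [hN0, hEs] at hn
    have h1 : ∑ t ∈ T0, xs (n, t) = ∑ t ∈ T0, xhi n t := by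
      apply Finset.sum_congr rfl
      intro s hs
      rw [hmem] at hs
      by_contra hlt
      exact hgt (hkkt n s tm (by linarith) (lt_of_le_of_ne (hbd n s).2 hlt))
    have h2 : ∑ t ∈ T0ᶜ, xlo n t ≤ ∑ t ∈ T0ᶜ, xs (n, t) :=
      Finset.sum_le_sum (fun t _ => (hbd n t).1)
    linarith
end

section
/- Let N, T be positive integers, let x, y : Fin N → Fin T → ℝ and ν : Fin T → ℝ satisfy y n t = x n t + ν t for all n, t, and assume ∑_{t} ν t = 0. Then ∑_{t with ν t > 0} ∑_{n} (x n t − y n t) = −(1/2) · ∑_{n} ∑_{t} |x n t − y n t|. -/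
/-- If `y n t = x n t + ν t` with `∑ t, ν t = 0`, then the cut violation over the set
`{t | ν t > 0}` equals minus half the ℓ¹ distance between `x` and `y`. -/
theorem cut_violation_eq_half_l1
    (N T : ℕ) (hN : 0 < N) (hT : 0 < T)
    (x y : Fin N → Fin T → ℝ) (ν : Fin T → ℝ)
    (hxy : ∀ n t, y n t = x n t + ν t) (hν : ∑ t, ν t = 0) :
    ∑ t ∈ Finset.univ.filter (fun t => 0 < ν t), ∑ n, (x n t - y n t)
      = -(1 / 2) * ∑ n, ∑ t, |x n t - y n t| := by
  have h : ∀ n t, x n t - y n t = -ν t := fun n t => by rw [hxy]; ring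
  have key : ∑ t, |ν t| = 2 * ∑ t ∈ Finset.univ.filter (fun t => 0 < ν t), ν t := by
    have h2 : ∑ t, |ν t| + ∑ t, ν t
        = 2 * ∑ t ∈ Finset.univ.filter (fun t => 0 < ν t), ν t := by
      rw [← Finset.sum_add_distrib, Finset.sum_filter, Finset.mul_sum]
      refine Finset.sum_congr rfl fun t _ => ?_
      split_ifs with ht
      · rw [abs_of_pos ht]; ring
      · rw [abs_of_nonpos (not_lt.mp ht)]; ring
    rw [hν, add_zero] at h2
    exact h2
  simp only [h, abs_neg, Finset.sum_const, Finset.card_univ, Fintype.card_fin, nsmul_eq_mul]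
  rw [key, ← Finset.mul_sum, Finset.sum_neg_distrib]
  ring
end

section
/- Let T ≥ 2 be an integer and u : Fin T → ℝ with ∑_{t} u t = 0. Then (max_{t} u t) − (min_{t} u t) ≥ (√T / (T − 1)) · √(∑_{t} (u t)²). -/
/-- For a mean-zero vector `u ∈ ℝ^T` (`T ≥ 2`), the spread `max u - min u` is at least
`(√T / (T - 1))` times the ℓ² norm of `u`. -/
theorem spread_ge_norm
    (T : ℕ) (hT : 2 ≤ T) (u : Fin T → ℝ) (hsum : ∑ t, u t = 0)
    (tmax tmin : Fin T) (hmax : ∀ t, u t ≤ u tmax) (hmin : ∀ t, u tmin ≤ u t) :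
    u tmax - u tmin ≥ (Real.sqrt T / ((T : ℝ) - 1)) * Real.sqrt (∑ t, (u t) ^ 2) := by
  have hT' : (2 : ℝ) ≤ T := by exact_mod_cast hT
  have hD : 0 ≤ u tmax - u tmin := sub_nonneg.2 (hmax tmin)
  have h1 : 0 ≤ ∑ t, (u tmax - u t) * (u t - u tmin) :=
    Finset.sum_nonneg fun t _ => mul_nonneg (sub_nonneg.2 (hmax t)) (sub_nonneg.2 (hmin t))
  have h2 : ∑ t, (u tmax - u t) * (u t - u tmin)
      = (u tmax + u tmin) * ∑ t, u t - ∑ t, (u t) ^ 2 - T * (u tmax * u tmin) := by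
    have h3 : (T : ℝ) * (u tmax * u tmin) = ∑ _t : Fin T, u tmax * u tmin := by simp
    rw [h3, Finset.mul_sum, ← Finset.sum_sub_distrib, ← Finset.sum_sub_distrib]
    exact Finset.sum_congr rfl fun t _ => by ring
  rw [h2, hsum] at h1
  have h4 : ∑ t, (u t) ^ 2 ≤ T * ((u tmax - u tmin) ^ 2 / 4) := by
    have h5 : (0 : ℝ) ≤ T * (u tmax + u tmin) ^ 2 := by positivity
    linarith
  have h6 : (T : ℝ) * ∑ t, (u t) ^ 2 ≤ (((T : ℝ) - 1) * (u tmax - u tmin)) ^ 2 := by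
    calc (T : ℝ) * ∑ t, (u t) ^ 2 ≤ T * (T * ((u tmax - u tmin) ^ 2 / 4)) := by gcongr
      _ = ((T : ℝ) / 2 * (u tmax - u tmin)) ^ 2 := by ring
      _ ≤ _ := by
        gcongr
        linarith
  rw [ge_iff_le, div_mul_eq_mul_div, div_le_iff₀ (by linarith), ← Real.sqrt_mul (by positivity),
    mul_comm (u tmax - u tmin)]
  exact Real.sqrt_le_iff.2 ⟨mul_nonneg (by linarith) hD, h6⟩
end

section
/- Let T ≥ 1 and N ≥ 1, let k : Fin N → ℕ, and for each n let A n : Matrix (Fin (k n)) (Fin T) ℝ and b n : Fin (k n) → ℝ; let p : Fin T → ℝ. Then there exists x : Fin N → Fin T → ℝ with ∑_{n} x n = p (componentwise) and A n *ᵥ (x n) ≤ b n for all n, if and only if for every λ0 : Fin T → ℝ and every family λ with λ n : Fin (k n) → ℝ, λ n ≥ 0 for all n, and (A n)ᵀ *ᵥ (λ n) = −λ0 for all n, one has λ0 ⬝ᵥ p + ∑_{n} (λ n) ⬝ᵥ (b n) ≥ 0. -/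
open Matrix

/-- One-variable elimination step. -/
lemma one_var {ι : Type} [Fintype ι] (a r : ι → ℝ) (h0 : ∀ i, a i = 0 → 0 ≤ r i)
    (h1 : ∀ i j, 0 < a i → a j < 0 → 0 ≤ (-a j) * r i + a i * r j) :
    ∃ s : ℝ, ∀ i, a i * s ≤ r i := by
  classical
  by_cases hn : (Finset.univ.filter fun j => a j < 0).Nonempty
  · obtain ⟨j, hj, hmax⟩ := Finset.exists_max_image _ (fun j => r j / a j) hn
    simp only [Finset.mem_filter, Finset.mem_univ, true_and] at hj hmax
    refine ⟨r j / a j, fun i => ?_⟩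
    rcases lt_trichotomy (a i) 0 with h | h | h
    · have h2 := mul_le_mul_of_nonpos_left (hmax i h) h.le
      rwa [mul_div_cancel₀ _ h.ne] at h2
    · rw [h, zero_mul]; exact h0 i h
    · have h2 := h1 i j h hj
      rw [← mul_div_assoc, div_le_iff_of_neg hj]
      linarith
  · have hn' : ∀ j, 0 ≤ a j := fun j => by
      by_contra hj
      exact hn ⟨j, by simpa using hj⟩
    by_cases hp : (Finset.univ.filter fun j => 0 < a j).Nonempty
    · obtain ⟨j, hj, hmin⟩ := Finset.exists_min_image _ (fun j => r j / a j) hp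
      simp only [Finset.mem_filter, Finset.mem_univ, true_and] at hj hmin
      refine ⟨r j / a j, fun i => ?_⟩
      rcases (hn' i).eq_or_lt with h | h
      · rw [← h, zero_mul]; exact h0 i h.symm
      · have h2 := mul_le_mul_of_nonneg_left (hmin i h) h.le
        rwa [mul_div_cancel₀ _ h.ne'] at h2
    · refine ⟨0, fun i => ?_⟩
      rw [mul_zero]
      refine h0 i (le_antisymm ?_ (hn' i))
      by_contra hi
      exact hp ⟨i, by simpa using hi⟩

/-- Affine Farkas lemma by Fourier–Motzkin elimination. -/
lemma farkas_fin (d : ℕ) : ∀ (ι : Type) [Fintype ι] (a : ι → Fin d → ℝ) (c : ι → ℝ),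
    (∀ l : ι → ℝ, (∀ i, 0 ≤ l i) → (∀ t, ∑ i, l i * a i t = 0) → 0 ≤ ∑ i, l i * c i) →
    ∃ x : Fin d → ℝ, ∀ i, ∑ t, a i t * x t ≤ c i := by
  classical
  induction d with
  | zero =>
    intro ι _ a c h
    refine ⟨0, fun i => ?_⟩
    have := h (Pi.single i 1) (fun j => by
      by_cases hj : j = i
      · subst hj; simp
      · simp [hj]) (fun t => t.elim0)
    simpa [Pi.single_apply] using this
  | succ d ih =>
    intro ι _ a c h
    let M : ι ⊕ ι × ι → ι → ℝ := fun q => match q with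
      | .inl i => if a i 0 = 0 then Pi.single i 1 else 0
      | .inr (i, j) => if 0 < a i 0 ∧ a j 0 < 0 then
          fun m => (-a j 0) * (Pi.single i 1 : ι → ℝ) m + a i 0 * (Pi.single j 1 : ι → ℝ) m else 0
    have single_nn : ∀ i m : ι, 0 ≤ (Pi.single i 1 : ι → ℝ) m := fun i m => by
      rw [Pi.single_apply]; split_ifs <;> norm_num
    have M_nn : ∀ q m, 0 ≤ M q m := by
      rintro (i | ⟨i, j⟩) m
      · simp only [M]; split_ifs
        · exact single_nn i m
        · simp
      · simp only [M]; split_ifs with hh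
        · exact add_nonneg (mul_nonneg (by linarith [hh.2]) (single_nn i m))
            (mul_nonneg hh.1.le (single_nn j m))
        · simp
    have sumS : ∀ (i : ι) (f : ι → ℝ), ∑ m, (Pi.single i 1 : ι → ℝ) m * f m = f i := by
      intro i f; simp [Pi.single_apply]
    have sumP : ∀ (u v : ℝ) (i j : ι) (f : ι → ℝ),
        ∑ m, (u * (Pi.single i 1 : ι → ℝ) m + v * (Pi.single j 1 : ι → ℝ) m) * f m
          = u * f i + v * f j := by
      intro u v i j f
      simp only [add_mul, Finset.sum_add_distrib, mul_assoc, ← Finset.mul_sum, sumS]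
    have M0 : ∀ q, ∑ m, M q m * a m 0 = 0 := by
      rintro (i | ⟨i, j⟩)
      · simp only [M]; split_ifs with hh
        · rw [sumS, hh]
        · simp
      · simp only [M]; split_ifs with hh
        · rw [sumP (-a j 0) (a i 0) i j (fun m => a m 0)]; ring
        · simp
    have swap : ∀ (l : ι ⊕ ι × ι → ℝ) (f : ι → ℝ),
        ∑ m, (∑ q, l q * M q m) * f m = ∑ q, l q * ∑ m, M q m * f m := by
      intro l f
      simp only [Finset.sum_mul, Finset.mul_sum, mul_assoc]
      exact Finset.sum_comm
    obtain ⟨x, hx⟩ := ih (ι ⊕ ι × ι) (fun q t => ∑ m, M q m * a m t.succ)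
      (fun q => ∑ m, M q m * c m) (by
        intro l hl ht
        rw [← swap l c]
        refine h _ (fun m => Finset.sum_nonneg fun q _ => mul_nonneg (hl q) (M_nn q m)) ?_
        intro t
        rw [swap l (fun m => a m t)]
        refine Fin.cases ?_ (fun t => ht t) t
        simp [M0])
    let r : ι → ℝ := fun i => c i - ∑ t : Fin d, a i t.succ * x t
    have hr : ∀ q, 0 ≤ ∑ m, M q m * r m := by
      intro q
      have h1 := hx q
      have h2 : ∑ t, (∑ m, M q m * a m t.succ) * x t
          = ∑ m, M q m * ∑ t : Fin d, a m t.succ * x t := by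
        simp only [Finset.sum_mul, Finset.mul_sum, mul_assoc]
        exact Finset.sum_comm
      simp only [r, mul_sub, Finset.sum_sub_distrib]
      linarith
    obtain ⟨s, hs⟩ := one_var (fun i => a i 0) r
      (fun i hi => by
        have := hr (.inl i)
        simp only [M] at this
        rwa [if_pos hi, sumS] at this)
      (fun i j hi hj => by
        have := hr (.inr (i, j))
        simp only [M] at this
        rwa [if_pos ⟨hi, hj⟩, sumP] at this)
    refine ⟨Fin.cons s x, fun i => ?_⟩
    have := hs i
    simp only [r] at this
    simp only [Fin.sum_univ_succ, Fin.cons_zero, Fin.cons_succ]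
    linarith

lemma farkas_gen {V : Type} [Fintype V] (ι : Type) [Fintype ι] (a : ι → V → ℝ) (c : ι → ℝ)
    (h : ∀ l : ι → ℝ, (∀ i, 0 ≤ l i) → (∀ t, ∑ i, l i * a i t = 0) → 0 ≤ ∑ i, l i * c i) :
    ∃ x : V → ℝ, ∀ i, ∑ t, a i t * x t ≤ c i := by
  let e := Fintype.equivFin V
  obtain ⟨x, hx⟩ := farkas_fin _ ι (fun i t => a i (e.symm t)) c
    (fun l hl ht => h l hl fun t => by simpa using ht (e t))
  refine ⟨fun v => x (e v), fun i => ?_⟩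
  rw [← e.symm.sum_comp]
  simpa using hx i

/-- Farkas-type duality characterization of disaggregability with polyhedral
individual constraint sets `X_n = {x_n | A n *ᵥ x_n ≤ b n}`. -/
theorem disaggregable_iff_dual_cone
    (T N : ℕ) (hT : 1 ≤ T) (hN : 1 ≤ N)
    (k : Fin N → ℕ)
    (A : (n : Fin N) → Matrix (Fin (k n)) (Fin T) ℝ)
    (b : (n : Fin N) → Fin (k n) → ℝ)
    (p : Fin T → ℝ) :
    (∃ x : Fin N → Fin T → ℝ, (∑ n, x n) = p ∧ ∀ n, A n *ᵥ x n ≤ b n) ↔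
    (∀ (l0 : Fin T → ℝ) (lam : (n : Fin N) → Fin (k n) → ℝ),
      (∀ n, 0 ≤ lam n) → (∀ n, (A n)ᵀ *ᵥ lam n = -l0) →
      0 ≤ l0 ⬝ᵥ p + ∑ n, lam n ⬝ᵥ b n) := by
  classical
  constructor
  · rintro ⟨x, rfl, hx⟩ l0 lam hl hA
    rw [dotProduct_sum, ← Finset.sum_add_distrib]
    refine Finset.sum_nonneg fun n _ => ?_
    have h1 : lam n ⬝ᵥ (A n *ᵥ x n) ≤ lam n ⬝ᵥ b n :=
      dotProduct_le_dotProduct_of_nonneg_left (hx n) (hl n)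
    have h2 : lam n ⬝ᵥ (A n *ᵥ x n) = - (l0 ⬝ᵥ x n) := by
      rw [dotProduct_mulVec, ← mulVec_transpose, hA n, neg_dotProduct]
    linarith
  · intro h
    let a : ((Σ n, Fin (k n)) ⊕ (Fin T ⊕ Fin T)) → Fin N × Fin T → ℝ := fun q v =>
      match q with
      | .inl ⟨n, i⟩ => if v.1 = n then A n i v.2 else 0
      | .inr (.inl t) => if v.2 = t then 1 else 0
      | .inr (.inr t) => if v.2 = t then -1 else 0
    let c : ((Σ n, Fin (k n)) ⊕ (Fin T ⊕ Fin T)) → ℝ := fun q =>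
      match q with
      | .inl ⟨n, i⟩ => b n i
      | .inr (.inl t) => p t
      | .inr (.inr t) => - p t
    obtain ⟨x, hx⟩ := farkas_gen _ a c (by
      intro l hl ht
      have key := h (fun t => l (.inr (.inl t)) - l (.inr (.inr t)))
        (fun n i => l (.inl ⟨n, i⟩)) (fun n i => hl _) (fun n => by
          ext t
          have := ht (n, t)
          simp only [Fintype.sum_sum_type, Fintype.sum_sigma, a] at this
          rw [Finset.sum_eq_single n (by
            intro m _ hm
            simp [hm.symm]) (by simp)] at this
          simp at this
          simp only [mulVec, dotProduct, transpose_apply, Pi.neg_apply]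
          simp only [mul_comm (A n _ t)]
          linarith)
      simp only [Fintype.sum_sum_type, Fintype.sum_sigma, c]
      simp only [dotProduct, sub_mul, Finset.sum_sub_distrib] at key
      simp only [mul_neg, Finset.sum_neg_distrib]
      linarith)
    refine ⟨fun n t => x (n, t), ?_, ?_⟩
    · ext t
      have h1 := hx (.inr (.inl t))
      have h2 := hx (.inr (.inr t))
      simp [a, c, Fintype.sum_prod_type] at h1 h2
      rw [Finset.sum_apply]
      linarith
    · intro n i
      have h1 := hx (.inl ⟨n, i⟩)
      simp only [a, c, Fintype.sum_prod_type] at h1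
      rw [Finset.sum_eq_single n (by
            intro m _ hm
            simp [hm]) (by simp)] at h1
      simpa [mulVec, dotProduct] using h1
end

section
/- Let T ≥ 1 and N ≥ 1, let k : Fin N → ℕ, and for each n let A n : Matrix (Fin (k n)) (Fin T) ℝ and b n : Fin (k n) → ℝ. Then there exist a natural number d and families μ0 : Fin d → (Fin T → ℝ) and μ : Fin d → ((n : Fin N) → Fin (k n) → ℝ) such that for every i, μ i n ≥ 0 and (A n)ᵀ *ᵥ (μ i n) = −(μ0 i) for all n, and such that for EVERY p : Fin T → ℝ: there exists x : Fin N → Fin T → ℝ with ∑_{n} x n = p and A n *ᵥ (x n) ≤ b n for all n, if and only if for every i : Fin d, (μ0 i) ⬝ᵥ p + ∑_{n} (μ i n) ⬝ᵥ (b n) ≥ 0. -/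
open Matrix

/-- Eliminating one variable. -/
lemma fm_one {ι : Type} [Fintype ι] [DecidableEq ι] (a : ι → ℝ) :
    ∃ W : Matrix (ι × ι) ι ℝ, (∀ k i, 0 ≤ W k i) ∧ W *ᵥ a = 0 ∧
      ∀ r : ι → ℝ, 0 ≤ W *ᵥ r → ∃ t : ℝ, ∀ i, a i * t ≤ r i := by
  classical
  let W : Matrix (ι × ι) ι ℝ := fun k =>
    if a k.1 = 0 then Pi.single k.1 1
    else if 0 < a k.1 ∧ a k.2 < 0 then Pi.single k.1 (-a k.2) + Pi.single k.2 (a k.1)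
    else 0
  have hW : ∀ (r : ι → ℝ) k, (W *ᵥ r) k = if a k.1 = 0 then r k.1
      else if 0 < a k.1 ∧ a k.2 < 0 then (-a k.2) * r k.1 + a k.1 * r k.2 else 0 := by
    intro r k
    simp only [Matrix.mulVec, W]
    split_ifs
    · simp
    · change (Pi.single k.1 (-a k.2) + Pi.single k.2 (a k.1)) ⬝ᵥ r = _
      rw [add_dotProduct]
      simp
    · simp
  have hs : ∀ (i : ι) (c : ℝ), 0 ≤ c → ∀ j, 0 ≤ (Pi.single i c : ι → ℝ) j := by
    intro i c hc j
    by_cases h : j = i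
    · subst h; simpa using hc
    · simp [h]
  refine ⟨W, ?_, ?_, ?_⟩
  · intro k i
    simp only [W]
    split_ifs with h1 h2
    · exact hs _ _ zero_le_one _
    · exact add_nonneg (hs _ _ (by linarith [h2.2]) _) (hs _ _ h2.1.le _)
    · exact le_rfl
  · funext k
    rw [hW]
    split_ifs with h1 h2
    · simpa using h1
    · simp; ring
    · rfl
  · intro r hr
    have hz : ∀ i, a i = 0 → 0 ≤ r i := by
      intro i hi
      have := hr (i, i)
      rw [hW] at this
      simpa [hi] using this
    have hpn : ∀ i j, 0 < a i → a j < 0 → 0 ≤ (-a j) * r i + a i * r j := by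
      intro i j hi hj
      have := hr (i, j)
      rw [hW] at this
      simpa [hi, hj, hi.ne'] using this
    by_cases hN : (Finset.univ.filter (fun j => a j < 0)).Nonempty
    · obtain ⟨j, hj, hmax⟩ := Finset.exists_max_image _ (fun j => r j / a j) hN
      simp only [Finset.mem_filter, Finset.mem_univ, true_and] at hj hmax
      refine ⟨r j / a j, fun i => ?_⟩
      rcases lt_trichotomy (a i) 0 with h | h | h
      · have := mul_le_mul_of_nonpos_left (hmax i h) h.le
        rwa [mul_div_cancel₀ _ h.ne] at this
      · rw [h, zero_mul]; exact hz i h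
      · have := hpn i j h hj
        rw [← mul_div_assoc, div_le_iff_of_neg hj]
        linarith
    · have hN' : ∀ i, 0 ≤ a i := by
        intro i
        by_contra h
        exact hN ⟨i, by simpa using h⟩
      by_cases hP : (Finset.univ.filter (fun j => 0 < a j)).Nonempty
      · obtain ⟨j, hj, hmin⟩ := Finset.exists_min_image _ (fun j => r j / a j) hP
        simp only [Finset.mem_filter, Finset.mem_univ, true_and] at hj hmin
        refine ⟨r j / a j, fun i => ?_⟩
        rcases (hN' i).eq_or_lt with h | h
        · rw [← h, zero_mul]; exact hz i h.symm
        · have := mul_le_mul_of_nonneg_left (hmin i h) h.le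
          rwa [mul_div_cancel₀ _ h.ne'] at this
      · refine ⟨0, fun i => ?_⟩
        rw [mul_zero]
        apply hz
        by_contra h
        exact hP ⟨i, by simpa using lt_of_le_of_ne (hN' i) (Ne.symm h)⟩

/-- Fourier–Motzkin elimination, with certificates. -/
lemma fm_all (m : ℕ) : ∀ {ι : Type} [Fintype ι] [DecidableEq ι] (M : Matrix ι (Fin m) ℝ),
    ∃ (d : ℕ) (C : Matrix (Fin d) ι ℝ), (∀ k i, 0 ≤ C k i) ∧ C * M = 0 ∧
      ∀ r : ι → ℝ, 0 ≤ C *ᵥ r → ∃ y : Fin m → ℝ, M *ᵥ y ≤ r := by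
  induction m with
  | zero =>
    intro ι _ _ M
    let e := Fintype.equivFin ι
    refine ⟨Fintype.card ι, fun k => Pi.single (e.symm k) 1, ?_, ?_, ?_⟩
    · intro k i
      by_cases h : i = e.symm k
      · subst h; simp
      · simp [h]
    · ext k i; exact i.elim0
    · intro r hr
      refine ⟨0, fun i => ?_⟩
      have := hr (e i)
      simpa [Matrix.mulVec] using this
  | succ m ih =>
    intro ι _ _ M
    obtain ⟨W, hW0, hWa, hW⟩ := fm_one (fun i => M i 0)
    let M' : Matrix ι (Fin m) ℝ := fun i j => M i j.succ
    obtain ⟨d, C, hC0, hCM, hC⟩ := ih (W * M')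
    refine ⟨d, C * W, ?_, ?_, ?_⟩
    · intro k i
      exact Finset.sum_nonneg fun j _ => mul_nonneg (hC0 _ _) (hW0 _ _)
    · ext k j
      refine Fin.cases ?_ (fun j => ?_) j
      · have : ((C * W) *ᵥ (fun i => M i 0)) k = 0 := by
          rw [← Matrix.mulVec_mulVec, hWa]; simp
        exact this
      · have : ((C * W) * M') k j = 0 := by
          rw [Matrix.mul_assoc, hCM]; rfl
        exact this
    · intro r hr
      rw [← Matrix.mulVec_mulVec] at hr
      obtain ⟨y, hy⟩ := hC _ hr
      obtain ⟨t, ht⟩ := hW (r - M' *ᵥ y) (by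
        rw [Matrix.mulVec_sub, Matrix.mulVec_mulVec]
        exact sub_nonneg.2 hy)
      refine ⟨Fin.cons t y, fun i => ?_⟩
      have h := ht i
      simp only [Pi.sub_apply, Matrix.mulVec, dotProduct, M'] at h
      simp only [Matrix.mulVec, dotProduct, Fin.sum_univ_succ, Fin.cons_zero, Fin.cons_succ]
      linarith

/-- Disaggregability with polyhedral individual constraint sets is characterized, for
every aggregate allocation `p` simultaneously, by a finite list of linear inequalities
coming from finitely many generators of the dual cone. -/
theorem disaggregable_iff_finitely_many_cuts
    (T N : ℕ) (hT : 1 ≤ T) (hN : 1 ≤ N)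
    (k : Fin N → ℕ)
    (A : (n : Fin N) → Matrix (Fin (k n)) (Fin T) ℝ)
    (b : (n : Fin N) → Fin (k n) → ℝ) :
    ∃ (d : ℕ) (μ0 : Fin d → (Fin T → ℝ)) (μ : Fin d → ((n : Fin N) → Fin (k n) → ℝ)),
      (∀ i n, 0 ≤ μ i n ∧ (A n)ᵀ *ᵥ μ i n = -(μ0 i)) ∧
      ∀ p : Fin T → ℝ,
        (∃ x : Fin N → Fin T → ℝ, (∑ n, x n) = p ∧ ∀ n, A n *ᵥ x n ≤ b n) ↔
        (∀ i, 0 ≤ μ0 i ⬝ᵥ p + ∑ n, μ i n ⬝ᵥ b n) := by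
  classical
  let e := Fintype.equivFin (Fin N × Fin T)
  let M : Matrix ((Σ n, Fin (k n)) ⊕ (Fin T ⊕ Fin T)) (Fin N × Fin T) ℝ := fun c v =>
    match c with
    | .inl s => if v.1 = s.1 then A s.1 s.2 v.2 else 0
    | .inr (.inl t) => if v.2 = t then 1 else 0
    | .inr (.inr t) => if v.2 = t then -1 else 0
  obtain ⟨d, C, hC0, hCM, hC⟩ := fm_all _ (M.submatrix id e.symm)
  have key : ∀ i n, (A n)ᵀ *ᵥ (fun j => C i (.inl ⟨n, j⟩)) =
      -(fun t => C i (.inr (.inl t)) - C i (.inr (.inr t))) := by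
    intro i n
    funext t
    have h := congrFun (congrFun hCM i) (e (n, t))
    have h : ∑ c, C i c * M c (n, t) = 0 := by
      rw [Matrix.mul_apply] at h
      simpa using h
    simp only [Fintype.sum_sum_type, Fintype.sum_sigma, M] at h
    have h1 : ∀ n' : Fin N, (∑ j, C i (.inl ⟨n', j⟩) * (if n = n' then A n' j t else 0)) =
        if n = n' then ∑ j, C i (.inl ⟨n', j⟩) * A n' j t else 0 := by
      intro n'; split_ifs <;> simp
    simp only [h1] at h
    simp only [Finset.sum_ite_eq, Finset.mem_univ, if_true, mul_ite, mul_one, mul_zero,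
      mul_neg] at h
    simp only [Matrix.mulVec, dotProduct, Matrix.transpose_apply, Pi.neg_apply]
    simp only [mul_comm (A n _ t)]
    linarith
  refine ⟨d, fun i t => C i (.inr (.inl t)) - C i (.inr (.inr t)),
    fun i n j => C i (.inl ⟨n, j⟩), fun i n => ⟨fun j => hC0 _ _, key i n⟩, fun p => ⟨?_, ?_⟩⟩
  · rintro ⟨x, rfl, hx⟩ i
    rw [dotProduct_sum, ← Finset.sum_add_distrib]
    refine Finset.sum_nonneg fun n _ => ?_
    have h1 : (fun j => C i (.inl ⟨n, j⟩)) ⬝ᵥ (A n *ᵥ x n) ≤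
        (fun j => C i (.inl ⟨n, j⟩)) ⬝ᵥ b n :=
      Finset.sum_le_sum fun j _ => mul_le_mul_of_nonneg_left (hx n j) (hC0 _ _)
    rw [Matrix.dotProduct_mulVec, ← Matrix.mulVec_transpose, key, neg_dotProduct] at h1
    linarith
  · intro h
    let r : ((Σ n, Fin (k n)) ⊕ (Fin T ⊕ Fin T)) → ℝ :=
      Sum.elim (fun s => b s.1 s.2) (Sum.elim p (-p))
    obtain ⟨y, hy⟩ := hC r (by
      intro i
      have := h i
      simp only [dotProduct, sub_mul, Finset.sum_sub_distrib] at this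
      simp only [Matrix.mulVec, dotProduct, Fintype.sum_sum_type, Fintype.sum_sigma, r,
        Sum.elim_inl, Sum.elim_inr, Pi.neg_apply, mul_neg, Finset.sum_neg_distrib, Pi.zero_apply]
      linarith)
    have hM : ∀ c, ∑ n, ∑ t, M c (n, t) * y (e (n, t)) ≤ r c := by
      intro c
      have h1 := hy c
      simp only [Matrix.mulVec, dotProduct, Matrix.submatrix_apply, id] at h1
      rw [← Equiv.sum_comp e, Fintype.sum_prod_type] at h1
      simpa using h1
    refine ⟨fun n t => y (e (n, t)), ?_, ?_⟩
    · funext t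
      have h1 := hM (.inr (.inl t))
      have h2 := hM (.inr (.inr t))
      simp [M, r] at h1 h2
      rw [Finset.sum_apply]
      linarith
    · intro n j
      have h1 := hM (.inl ⟨n, j⟩)
      have h2 : ∀ n' : Fin N, (∑ t, (if n' = n then A n j t else 0) * y (e (n', t))) =
          if n' = n then ∑ t, A n j t * y (e (n', t)) else 0 := by
        intro n'; split_ifs <;> simp
      simp only [M, r, h2, Finset.sum_ite_eq', Finset.mem_univ, if_true, Sum.elim_inl] at h1
      exact h1
end
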